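/- arXiv:1809.08765 — 2 statements merged into one kernel-verified Lean document; each statement's English description precedes it below -/
import Mathlib

section
/- Every Dirichlet eigenvalue of the right isosceles triangle T = {(x,y) ∈ ℝ² : 0 < x < y < 1} is of the form π²(j² + k²) for some positive integers j and k with j < k. That is, if u : ℝ² → ℝ is continuous on the closure of T, twice continuously differentiable on T, vanishes on the boundary ∂T, is not identically zero on T, and satisfies ∂²u/∂x² + ∂²u/∂y² = −λ·u at every point of T, then there exist positive integers j < k with λ = π²(j² + k²). -/
/-- The planar Laplacian `∂²u/∂x² + ∂²u/∂y²` of `u : ℝ × ℝ → ℝ` at a point `p`. -/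
noncomputable def lap2 (u : ℝ × ℝ → ℝ) (p : ℝ × ℝ) : ℝ :=
  deriv (deriv fun x => u (x, p.2)) p.1 + deriv (deriv fun y => u (p.1, y)) p.2

/-- The open right isosceles triangle with vertices `(0,0)`, `(0,1)`, `(1,1)`. -/
def rightIsoscelesTriangle : Set (ℝ × ℝ) := {p | 0 < p.1 ∧ p.1 < p.2 ∧ p.2 < 1}

open MeasureTheory Set

def Ktri : Set (ℝ × ℝ) := {p | 0 ≤ p.1 ∧ p.1 ≤ p.2 ∧ p.2 ≤ 1}

lemma isClosed_Ktri : IsClosed Ktri := by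
  apply IsClosed.inter (isClosed_le continuous_const continuous_fst)
  exact IsClosed.inter (isClosed_le continuous_fst continuous_snd)
    (isClosed_le continuous_snd continuous_const)

lemma isCompact_Ktri : IsCompact Ktri := by
  apply IsCompact.of_isClosed_subset (isCompact_Icc (a := ((0:ℝ),(0:ℝ))) (b := (1,1)))
    isClosed_Ktri
  rintro ⟨x, y⟩ ⟨h1, h2, h3⟩
  simp only at h1 h2 h3
  exact ⟨⟨h1, by simp only; linarith⟩, ⟨by simp only; linarith, h3⟩⟩

lemma Ktri_int (g : ℝ × ℝ → ℝ) (hg : ContinuousOn g Ktri) :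
    Integrable (Ktri.indicator g) (volume.prod volume) := by
  rw [integrable_indicator_iff isClosed_Ktri.measurableSet]
  exact hg.integrableOn_compact isCompact_Ktri

lemma Ktri_y (g : ℝ × ℝ → ℝ) (hg : ContinuousOn g Ktri) :
    ∫ p, Ktri.indicator g p = ∫ y in (0:ℝ)..1, ∫ x in (0:ℝ)..y, g (x, y) := by
  rw [Measure.volume_eq_prod, integral_prod_symm _ (Ktri_int g hg),
    intervalIntegral.integral_of_le zero_le_one, ← integral_Icc_eq_integral_Ioc,
    ← integral_indicator measurableSet_Icc]
  congr 1
  ext y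
  by_cases hy : y ∈ Icc (0:ℝ) 1
  · rw [indicator_of_mem hy, intervalIntegral.integral_of_le hy.1, ← integral_Icc_eq_integral_Ioc,
      ← integral_indicator measurableSet_Icc]
    congr 1
    ext x
    by_cases hx : x ∈ Icc 0 y
    · rw [indicator_of_mem hx, indicator_of_mem]
      exact ⟨hx.1, hx.2, hy.2⟩
    · rw [indicator_of_notMem hx, indicator_of_notMem]
      exact fun h => hx ⟨h.1, h.2.1⟩
  · rw [indicator_of_notMem hy]
    convert integral_zero ℝ ℝ with x
    rw [indicator_of_notMem]
    exact fun h => hy ⟨h.1.trans h.2.1, h.2.2⟩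

lemma Ktri_x (g : ℝ × ℝ → ℝ) (hg : ContinuousOn g Ktri) :
    ∫ p, Ktri.indicator g p = ∫ x in (0:ℝ)..1, ∫ y in x..1, g (x, y) := by
  rw [Measure.volume_eq_prod, integral_prod _ (Ktri_int g hg),
    intervalIntegral.integral_of_le zero_le_one, ← integral_Icc_eq_integral_Ioc,
    ← integral_indicator measurableSet_Icc]
  congr 1
  ext x
  by_cases hx : x ∈ Icc (0:ℝ) 1
  · rw [indicator_of_mem hx, intervalIntegral.integral_of_le hx.2, ← integral_Icc_eq_integral_Ioc,
      ← integral_indicator measurableSet_Icc]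
    congr 1
    ext y
    by_cases hy : y ∈ Icc x 1
    · rw [indicator_of_mem hy, indicator_of_mem]
      exact ⟨hx.1, hy.1, hy.2⟩
    · rw [indicator_of_notMem hy, indicator_of_notMem]
      exact fun h => hy ⟨h.2.1, h.2.2⟩
  · rw [indicator_of_notMem hx]
    convert integral_zero ℝ ℝ with y
    rw [indicator_of_notMem]
    exact fun h => hx ⟨h.1, h.2.1.trans h.2.2⟩

lemma green1 (a b : ℝ) (hab : a ≤ b) (f f' f'' p p' p'' : ℝ → ℝ)
    (hf : ∀ x ∈ Icc a b, HasDerivAt f (f' x) x) (hf' : ∀ x ∈ Icc a b, HasDerivAt f' (f'' x) x)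
    (hp : ∀ x, HasDerivAt p (p' x) x) (hp' : ∀ x, HasDerivAt p' (p'' x) x)
    (hc : ContinuousOn (fun x => p x * f'' x - f x * p'' x) (Icc a b))
    (ha : p a = 0) (hb : p b = 0) :
    ∫ x in a..b, (p x * f'' x - f x * p'' x) = f a * p' a - f b * p' b := by
  rw [intervalIntegral.integral_eq_sub_of_hasDerivAt (f := fun x => p x * f' x - f x * p' x)]
  · simp only [ha, hb]; ring
  · intro x hx
    rw [uIcc_of_le hab] at hx
    have := ((hp x).mul (hf' x hx)).sub ((hf x hx).mul (hp' x))
    rw [show p x * f'' x - f x * p'' x =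
      p' x * f' x + p x * f'' x - (f' x * p' x + f x * p'' x) by ring]
    exact this
  · apply ContinuousOn.intervalIntegrable
    rwa [uIcc_of_le hab]

lemma green2 (v vx vy vxx vyy p px py pxx pyy : ℝ → ℝ → ℝ) (l m : ℝ)
    (hx : ∀ x y, (x, y) ∈ Ktri → HasDerivAt (fun t => v t y) (vx x y) x)
    (hxx : ∀ x y, (x, y) ∈ Ktri → HasDerivAt (fun t => vx t y) (vxx x y) x)
    (hy : ∀ x y, (x, y) ∈ Ktri → HasDerivAt (fun t => v x t) (vy x y) y)
    (hyy : ∀ x y, (x, y) ∈ Ktri → HasDerivAt (fun t => vy x t) (vyy x y) y)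
    (px1 : ∀ x y, HasDerivAt (fun t => p t y) (px x y) x)
    (px2 : ∀ x y, HasDerivAt (fun t => px t y) (pxx x y) x)
    (py1 : ∀ x y, HasDerivAt (fun t => p x t) (py x y) y)
    (py2 : ∀ x y, HasDerivAt (fun t => py x t) (pyy x y) y)
    (cv : Continuous fun q : ℝ × ℝ => v q.1 q.2) (cp : Continuous fun q : ℝ × ℝ => p q.1 q.2)
    (cpx : Continuous fun q : ℝ × ℝ => pxx q.1 q.2)
    (cpy : Continuous fun q : ℝ × ℝ => pyy q.1 q.2)
    (cvx : ContinuousOn (fun q : ℝ × ℝ => vxx q.1 q.2) Ktri)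
    (cvy : ContinuousOn (fun q : ℝ × ℝ => vyy q.1 q.2) Ktri)
    (p0 : ∀ y, p 0 y = 0) (p1 : ∀ x, p x 1 = 0) (pd : ∀ x, p x x = 0)
    (ev : ∀ x y, (x, y) ∈ Ktri → vxx x y + vyy x y = -l * v x y)
    (ep : ∀ x y, pxx x y + pyy x y = -m * p x y) :
    (m - l) * ∫ y in (0:ℝ)..1, ∫ x in (0:ℝ)..y, v x y * p x y =
      (∫ y in (0:ℝ)..1, (v 0 y * px 0 y - v y y * px y y)) +
      ∫ x in (0:ℝ)..1, (v x x * py x x - v x 1 * py x 1) := by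
  set g1 : ℝ × ℝ → ℝ := fun q => p q.1 q.2 * vxx q.1 q.2 - v q.1 q.2 * pxx q.1 q.2 with hg1
  set g2 : ℝ × ℝ → ℝ := fun q => p q.1 q.2 * vyy q.1 q.2 - v q.1 q.2 * pyy q.1 q.2 with hg2
  have c1 : ContinuousOn g1 Ktri :=
    (cp.continuousOn.mul cvx).sub (cv.mul cpx).continuousOn
  have c2 : ContinuousOn g2 Ktri :=
    (cp.continuousOn.mul cvy).sub (cv.mul cpy).continuousOn
  have c3 : Continuous (fun q : ℝ × ℝ => v q.1 q.2 * p q.1 q.2) := cv.mul cp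
  have e1 : ∫ q, Ktri.indicator g1 q =
      ∫ y in (0:ℝ)..1, (v 0 y * px 0 y - v y y * px y y) := by
    rw [Ktri_y g1 c1]
    apply intervalIntegral.integral_congr
    intro y hy'
    rw [uIcc_of_le zero_le_one] at hy'
    refine green1 0 y hy'.1 (fun t => v t y) (fun t => vx t y) (fun t => vxx t y)
      (fun t => p t y) (fun t => px t y) (fun t => pxx t y) ?_ ?_ ?_ ?_ ?_ (p0 y) (pd y)
    · exact fun x h => hx x y ⟨h.1, h.2, hy'.2⟩
    · exact fun x h => hxx x y ⟨h.1, h.2, hy'.2⟩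
    · exact fun x => px1 x y
    · exact fun x => px2 x y
    · refine c1.comp (f := fun x : ℝ => (x, y)) (by fun_prop) ?_
      exact fun x h => ⟨h.1, h.2, hy'.2⟩
  have e2 : ∫ q, Ktri.indicator g2 q =
      ∫ x in (0:ℝ)..1, (v x x * py x x - v x 1 * py x 1) := by
    rw [Ktri_x g2 c2]
    apply intervalIntegral.integral_congr
    intro x hx'
    rw [uIcc_of_le zero_le_one] at hx'
    refine green1 x 1 hx'.2 (fun t => v x t) (fun t => vy x t) (fun t => vyy x t)
      (fun t => p x t) (fun t => py x t) (fun t => pyy x t) ?_ ?_ ?_ ?_ ?_ (pd x) (p1 x)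
    · exact fun y h => hy x y ⟨hx'.1, h.1, h.2⟩
    · exact fun y h => hyy x y ⟨hx'.1, h.1, h.2⟩
    · exact fun y => py1 x y
    · exact fun y => py2 x y
    · refine c2.comp (f := fun y : ℝ => (x, y)) (by fun_prop) ?_
      exact fun y h => ⟨hx'.1, h.1, h.2⟩
  rw [← e1, ← e2, ← Ktri_y (fun q => v q.1 q.2 * p q.1 q.2) c3.continuousOn,
    Measure.volume_eq_prod, ← integral_add (Ktri_int g1 c1) (Ktri_int g2 c2), ← integral_const_mul]
  congr 1
  ext ⟨x, y⟩
  by_cases h : (x, y) ∈ Ktri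
  · rw [indicator_of_mem h, indicator_of_mem h, indicator_of_mem h]
    simp only [hg1, hg2]
    linear_combination v x y * ep x y - p x y * ev x y h
  · rw [indicator_of_notMem h, indicator_of_notMem h, indicator_of_notMem h]; simp

/-- Completeness of the sines. -/
lemma sin_complete (f : ℝ → ℝ) (hf : Continuous f)
    (h : ∀ k : ℕ, 0 < k → ∫ x in (0:ℝ)..1, f x * Real.sin (k * Real.pi * x) = 0) :
    ∀ x ∈ Ioo (0:ℝ) 1, f x = 0 := by
  have h1 : ∀ n : ℕ, ∀ k : ℕ, 
      ∫ x in (0:ℝ)..1, f x * Real.cos (Real.pi * x) ^ n * Real.sin (k * Real.pi * x) = 0 := by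
    intro n
    induction n with
    | zero => 
      intro k
      rcases Nat.eq_zero_or_pos k with rfl | hk
      · simp
      · simpa using h k hk
    | succ n ih =>
      intro k
      rcases k with _ | k
      · simp
      have e : ∀ x : ℝ, f x * Real.cos (Real.pi * x) ^ (n+1) * Real.sin ((k+1 : ℕ) * Real.pi * x)
        = (1/2) * (f x * Real.cos (Real.pi * x) ^ n * Real.sin ((k+2 : ℕ) * Real.pi * x)
          + f x * Real.cos (Real.pi * x) ^ n * Real.sin (k * Real.pi * x)) := by
        intro x
        have a1 : ((k+2 : ℕ) : ℝ) * Real.pi * x = ((k+1 : ℕ) : ℝ) * Real.pi * x + Real.pi * x := by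
          push_cast; ring
        have a2 : (k : ℝ) * Real.pi * x = ((k+1 : ℕ) : ℝ) * Real.pi * x - Real.pi * x := by
          push_cast; ring
        rw [a1, a2, Real.sin_add, Real.sin_sub]; ring
      simp_rw [e]
      rw [intervalIntegral.integral_const_mul, intervalIntegral.integral_add, ih, ih]
      · simp
      · exact Continuous.intervalIntegrable (by fun_prop) _ _
      · exact Continuous.intervalIntegrable (by fun_prop) _ _
  have h2 : ∀ P : Polynomial ℝ,
      ∫ x in (0:ℝ)..1, f x * P.eval (Real.cos (Real.pi * x)) * Real.sin (Real.pi * x) = 0 := by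
    intro P
    have e : ∀ x : ℝ, f x * P.eval (Real.cos (Real.pi * x)) * Real.sin (Real.pi * x) =
        ∑ i ∈ Finset.range (P.natDegree + 1), P.coeff i *
          (f x * Real.cos (Real.pi * x) ^ i * Real.sin ((1:ℕ) * Real.pi * x)) := by
      intro x
      rw [Polynomial.eval_eq_sum_range, Finset.mul_sum, Finset.sum_mul]
      apply Finset.sum_congr rfl
      intro i _
      simp only [Nat.cast_one, one_mul]; ring
    simp_rw [e]
    rw [intervalIntegral.integral_finsetSum]
    · apply Finset.sum_eq_zero
      intro i _
      rw [intervalIntegral.integral_const_mul, h1, mul_zero]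
    · intro i _
      exact Continuous.intervalIntegrable (by fun_prop) _ _
  obtain ⟨M, hM⟩ := (isCompact_Icc (a := (0:ℝ)) (b := 1)).exists_bound_of_continuousOn
    hf.continuousOn
  have hpi := Real.pi_pos
  have h3 : ∀ ε > 0, |∫ x in (0:ℝ)..1, f x * f x * Real.sin (Real.pi * x)| ≤ M * ε := by
    intro ε hε
    obtain ⟨P, hP⟩ := exists_polynomial_near_of_continuousOn (-1) 1
      (fun t => f (Real.arccos t / Real.pi)) (by
        apply Continuous.continuousOn
        exact hf.comp (Real.continuous_arccos.div_const _)) ε hε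
    have e : ∫ x in (0:ℝ)..1, f x * f x * Real.sin (Real.pi * x) =
        ∫ x in (0:ℝ)..1, f x * (f x - P.eval (Real.cos (Real.pi * x))) * Real.sin (Real.pi * x) := by
      have e' : ∀ x : ℝ, f x * (f x - P.eval (Real.cos (Real.pi * x))) * Real.sin (Real.pi * x) =
          f x * f x * Real.sin (Real.pi * x) -
            f x * P.eval (Real.cos (Real.pi * x)) * Real.sin (Real.pi * x) := fun x => by ring
      simp_rw [e']
      rw [intervalIntegral.integral_sub, h2 P, sub_zero]
      · exact Continuous.intervalIntegrable (by fun_prop) _ _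
      · exact Continuous.intervalIntegrable (by fun_prop) _ _
    rw [e]
    have := intervalIntegral.norm_integral_le_of_norm_le_const (a := (0:ℝ)) (b := 1) (C := M * ε)
      (f := fun x => f x * (f x - P.eval (Real.cos (Real.pi * x))) * Real.sin (Real.pi * x)) ?_
    · simpa using this
    · intro x hx
      rw [uIoc_of_le zero_le_one] at hx
      have b1 := hM x ⟨hx.1.le, hx.2⟩
      have b2 := hP (Real.cos (Real.pi * x)) ⟨Real.neg_one_le_cos _, Real.cos_le_one _⟩
      rw [Real.arccos_cos (by nlinarith [hx.1]) (by nlinarith [hx.2]),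
        mul_div_cancel_left₀ _ hpi.ne', abs_sub_comm] at b2
      have b3 := Real.abs_sin_le_one (Real.pi * x)
      rw [Real.norm_eq_abs] at b1
      rw [norm_mul, norm_mul, Real.norm_eq_abs, Real.norm_eq_abs, Real.norm_eq_abs]
      calc _ ≤ M * ε * 1 := by
            have hM0 : 0 ≤ M := (abs_nonneg _).trans b1
            gcongr
        _ = _ := by ring
  have h4 : ∫ x in (0:ℝ)..1, f x * f x * Real.sin (Real.pi * x) = 0 := by
    by_contra hne
    have hpos := abs_pos.2 hne
    have hM0 : 0 ≤ M := (norm_nonneg _).trans (hM 0 ⟨le_rfl, zero_le_one⟩)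
    have := h3 (|∫ x in (0:ℝ)..1, f x * f x * Real.sin (Real.pi * x)| / (2 * (M + 1)))
      (by positivity)
    rw [mul_div_assoc', le_div_iff₀ (by positivity)] at this
    nlinarith
  intro x hx
  by_contra hne
  have : 0 < ∫ x in (0:ℝ)..1, f x * f x * Real.sin (Real.pi * x) := by
    apply intervalIntegral.integral_pos zero_lt_one
    · exact Continuous.continuousOn (by fun_prop)
    · intro y hy
      exact mul_nonneg (mul_self_nonneg _) (Real.sin_nonneg_of_nonneg_of_le_pi
        (by nlinarith [hy.1]) (by nlinarith [hy.2]))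
    · refine ⟨x, ⟨hx.1.le, hx.2.le⟩, mul_pos (mul_self_pos.2 hne)
        (Real.sin_pos_of_pos_of_lt_pi (by nlinarith [hx.1]) (by nlinarith [hx.2]))⟩
  linarith

lemma isOpen_tri : IsOpen rightIsoscelesTriangle := by
  apply IsOpen.inter (isOpen_lt continuous_const continuous_fst)
  exact IsOpen.inter (isOpen_lt continuous_fst continuous_snd)
    (isOpen_lt continuous_snd continuous_const)

/-- Partial derivatives of a `C²` function on the triangle. -/
lemma partials (w : ℝ × ℝ → ℝ) (hw : ContDiffOn ℝ 2 w rightIsoscelesTriangle) (e : ℝ × ℝ) :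
    ∃ w1 w2 : ℝ × ℝ → ℝ, ContinuousOn w2 rightIsoscelesTriangle ∧
      (∀ p ∈ rightIsoscelesTriangle, ∀ (c : ℝ → ℝ × ℝ) (r t : ℝ), c t = p →
        HasDerivAt c (r • e) t → HasDerivAt (fun s => w (c s)) (r * w1 p) t ∧
          HasDerivAt (fun s => w1 (c s)) (r * w2 p) t) := by
  have h1 : ContDiffOn ℝ 1 (fun p => fderiv ℝ w p e) rightIsoscelesTriangle :=
    (hw.fderiv_of_isOpen isOpen_tri (by norm_num)).clm_apply contDiffOn_const
  have h2 : ContDiffOn ℝ 0 (fun p => fderiv ℝ (fun p => fderiv ℝ w p e) p e)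
      rightIsoscelesTriangle :=
    (h1.fderiv_of_isOpen isOpen_tri (by norm_num)).clm_apply contDiffOn_const
  refine ⟨fun p => fderiv ℝ w p e, fun p => fderiv ℝ (fun p => fderiv ℝ w p e) p e,
    h2.continuousOn, ?_⟩
  intro p hp c r t hc hd
  subst hc
  have d1 := ((hw.differentiableOn (by norm_num)).differentiableAt
    (isOpen_tri.mem_nhds hp)).hasFDerivAt
  have d2 := ((h1.differentiableOn (by norm_num)).differentiableAt
    (isOpen_tri.mem_nhds hp)).hasFDerivAt
  constructor
  · have := d1.comp_hasDerivAt t hd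
    rw [map_smul, smul_eq_mul] at this
    exact this
  · have := d2.comp_hasDerivAt t hd
    rw [map_smul, smul_eq_mul] at this
    exact this

lemma lap_eq (w w1 w2 w1' w2' : ℝ × ℝ → ℝ)
    (h1 : (∀ p ∈ rightIsoscelesTriangle, ∀ (c : ℝ → ℝ × ℝ) (r t : ℝ), c t = p →
        HasDerivAt c (r • ((1:ℝ), (0:ℝ))) t → HasDerivAt (fun s => w (c s)) (r * w1 p) t ∧
          HasDerivAt (fun s => w1 (c s)) (r * w2 p) t))
    (h2 : (∀ p ∈ rightIsoscelesTriangle, ∀ (c : ℝ → ℝ × ℝ) (r t : ℝ), c t = p →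
        HasDerivAt c (r • ((0:ℝ), (1:ℝ))) t → HasDerivAt (fun s => w (c s)) (r * w1' p) t ∧
          HasDerivAt (fun s => w1' (c s)) (r * w2' p) t)) :
    ∀ p ∈ rightIsoscelesTriangle, lap2 w p = w2 p + w2' p := by
  rintro ⟨x, y⟩ hp
  have k1 : ∀ t : ℝ, HasDerivAt (fun s : ℝ => (s, y)) ((1:ℝ) • ((1:ℝ), (0:ℝ))) t := by
    intro t
    simpa using (hasDerivAt_id t).prodMk (hasDerivAt_const t y)
  have k2 : ∀ t : ℝ, HasDerivAt (fun s : ℝ => (x, s)) ((1:ℝ) • ((0:ℝ), (1:ℝ))) t := by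
    intro t
    simpa using (hasDerivAt_const t x).prodMk (hasDerivAt_id t)
  unfold lap2
  congr 1
  · have : deriv (fun t => w (t, y)) =ᶠ[nhds x] fun t => w1 (t, y) := by
      have : ∀ᶠ t in nhds x, (t, y) ∈ rightIsoscelesTriangle :=
        (isOpen_tri.preimage (f := fun t : ℝ => (t, y)) (by fun_prop)).mem_nhds hp
      filter_upwards [this] with t ht
      simpa using (h1 _ ht (fun s => (s, y)) _ _ rfl (k1 t)).1.deriv
    rw [this.deriv_eq]
    simpa using (h1 _ hp (fun s => (s, y)) _ _ rfl (k1 x)).2.deriv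
  · have : deriv (fun t => w (x, t)) =ᶠ[nhds y] fun t => w1' (x, t) := by
      have : ∀ᶠ t in nhds y, (x, t) ∈ rightIsoscelesTriangle :=
        (isOpen_tri.preimage (f := fun t : ℝ => (x, t)) (by fun_prop)).mem_nhds hp
      filter_upwards [this] with t ht
      simpa using (h2 _ ht _ _ _ rfl (k2 t)).1.deriv
    rw [this.deriv_eq]
    simpa using (h2 _ hp _ _ _ rfl (k2 y)).2.deriv

lemma hasDerivAt_sin_mul (a x : ℝ) :
    HasDerivAt (fun t => Real.sin (a * t)) (a * Real.cos (a * x)) x := by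
  have := ((hasDerivAt_id x).const_mul a).sin
  simpa [mul_comm] using this

lemma hasDerivAt_cos_mul (a x : ℝ) :
    HasDerivAt (fun t => Real.cos (a * t)) (-(a * Real.sin (a * x))) x := by
  have := ((hasDerivAt_id x).const_mul a).cos
  simpa [mul_comm] using this

lemma ortho (lam : ℝ) (w : ℝ × ℝ → ℝ) (hc : Continuous w)
    (h0 : ∀ p, p ∉ rightIsoscelesTriangle → w p = 0)
    (hw : ContDiffOn ℝ 2 w rightIsoscelesTriangle)
    (hl : ∀ p ∈ rightIsoscelesTriangle, lap2 w p = -lam * w p)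
    (a b : ℝ) (ha : Real.sin a = 0) (hb : Real.sin b = 0) :
    ((a ^ 2 + b ^ 2) - lam) * ∫ y in (0:ℝ)..1, ∫ x in (0:ℝ)..y,
      w (x, y) * (Real.sin (a * x) * Real.sin (b * y) - Real.sin (b * x) * Real.sin (a * y))
      = 0 := by
  obtain ⟨w1, w2, cw2, hw1⟩ := partials w hw (1, 0)
  obtain ⟨w1', w2', cw2', hw1'⟩ := partials w hw (0, 1)
  have hlap := lap_eq w w1 w2 w1' w2' hw1 hw1'
  set h : ℝ → ℝ → ℝ → ℝ × ℝ := fun s x y => ((1 - s) / 4 + s * x, (1 - s) / 2 + s * y) with hh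
  have hmem : ∀ s ∈ Ioo (0:ℝ) 1, ∀ x y, (x, y) ∈ Ktri → h s x y ∈ rightIsoscelesTriangle := by
    rintro s ⟨s0, s1⟩ x y ⟨k1, k2, k3⟩
    simp only at k1 k2 k3
    refine ⟨?_, ?_, ?_⟩ <;> simp only [hh] <;> nlinarith
  have dx : ∀ s x y : ℝ, HasDerivAt (fun t => h s t y) (s • ((1:ℝ), (0:ℝ))) x := by
    intro s x y
    have := (((hasDerivAt_id x).const_mul s).const_add ((1 - s) / 4)).prodMk
      (hasDerivAt_const x ((1 - s) / 2 + s * y))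
    simpa using this
  have dy : ∀ s x y : ℝ, HasDerivAt (fun t => h s x t) (s • ((0:ℝ), (1:ℝ))) y := by
    intro s x y
    have := (hasDerivAt_const y ((1 - s) / 4 + s * x)).prodMk
      (((hasDerivAt_id y).const_mul s).const_add ((1 - s) / 2))
    simpa using this
  set S : ℝ → ℝ → ℝ := fun a x => Real.sin (a * x) with hS
  set C : ℝ → ℝ → ℝ := fun a x => Real.cos (a * x) with hC
  have dS : ∀ a x, HasDerivAt (S a) (a * C a x) x := hasDerivAt_sin_mul
  have dC : ∀ a x, HasDerivAt (C a) (-(a * S a x)) x := hasDerivAt_cos_mul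
  have cS : ∀ a, Continuous (S a) := fun a => by simp only [hS]; fun_prop
  have cC : ∀ a, Continuous (C a) := fun a => by simp only [hC]; fun_prop
  have S0 : ∀ a, S a 0 = 0 := by simp [hS]
  have S1 : S a 1 = 0 ∧ S b 1 = 0 := by simp [hS, ha, hb]
  have key : ∀ s ∈ Ioo (0:ℝ) 1,
      ((a ^ 2 + b ^ 2) - s ^ 2 * lam) * (∫ y in (0:ℝ)..1, ∫ x in (0:ℝ)..y,
        w (h s x y) * (S a x * S b y - S b x * S a y)) =
      (∫ y in (0:ℝ)..1, (w (h s 0 y) * (a * C a 0 * S b y - b * C b 0 * S a y)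
        - w (h s y y) * (a * C a y * S b y - b * C b y * S a y))) +
      ∫ x in (0:ℝ)..1, (w (h s x x) * (S a x * (b * C b x) - S b x * (a * C a x))
        - w (h s x 1) * (S a x * (b * C b 1) - S b x * (a * C a 1))) := by
    intro s hs
    have ch : Continuous fun q : ℝ × ℝ => h s q.1 q.2 := by simp only [hh]; fun_prop
    refine green2 (fun x y => w (h s x y)) (fun x y => s * w1 (h s x y))
      (fun x y => s * w1' (h s x y)) (fun x y => s * (s * w2 (h s x y)))
      (fun x y => s * (s * w2' (h s x y)))
      (fun x y => S a x * S b y - S b x * S a y)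
      (fun x y => a * C a x * S b y - b * C b x * S a y)
      (fun x y => S a x * (b * C b y) - S b x * (a * C a y))
      (fun x y => a * (-(a * S a x)) * S b y - b * (-(b * S b x)) * S a y)
      (fun x y => S a x * (b * (-(b * S b y))) - S b x * (a * (-(a * S a y))))
      (s ^ 2 * lam) (a ^ 2 + b ^ 2) ?_ ?_ ?_ ?_ ?_ ?_ ?_ ?_ ?_ ?_ ?_ ?_ ?_ ?_ ?_ ?_ ?_ ?_ ?_
    · exact fun x y hK => (hw1 _ (hmem s hs x y hK) (fun t => h s t y) _ _ rfl (dx s x y)).1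
    · exact fun x y hK => ((hw1 _ (hmem s hs x y hK) (fun t => h s t y) _ _ rfl (dx s x y)).2).const_mul s
    · exact fun x y hK => (hw1' _ (hmem s hs x y hK) _ _ _ rfl (dy s x y)).1
    · exact fun x y hK => ((hw1' _ (hmem s hs x y hK) _ _ _ rfl (dy s x y)).2).const_mul s
    · exact fun x y => ((dS a x).mul_const _).sub ((dS b x).mul_const _)
    · exact fun x y => (((dC a x).const_mul _).mul_const _).sub (((dC b x).const_mul _).mul_const _)
    · exact fun x y => ((dS b y).const_mul _).sub ((dS a y).const_mul _)
    · exact fun x y => (((dC b y).const_mul _).const_mul _).sub (((dC a y).const_mul _).const_mul _)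
    · exact hc.comp ch
    · fun_prop
    · fun_prop
    · fun_prop
    · refine continuousOn_const.mul (continuousOn_const.mul (cw2.comp ch.continuousOn ?_))
      exact fun q hq => hmem s hs q.1 q.2 hq
    · refine continuousOn_const.mul (continuousOn_const.mul (cw2'.comp ch.continuousOn ?_))
      exact fun q hq => hmem s hs q.1 q.2 hq
    · intro y; simp [S0]
    · intro x; simp [S1]
    · intro x; ring
    · intro x y hK
      have e1 := hlap _ (hmem s hs x y hK)
      rw [hl _ (hmem s hs x y hK)] at e1
      linear_combination (-s^2) * e1
    · intro x y; ring
  have cw : Continuous fun q : ℝ × ℝ × ℝ => w (h q.1 q.2.1 q.2.2) :=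
    hc.comp (by simp only [hh]; fun_prop)
  have cwc : ∀ {X : Type} [TopologicalSpace X] (f g k : X → ℝ), Continuous f → Continuous g →
      Continuous k → Continuous fun x => w (h (f x) (g x) (k x)) := by
    intro X _ f g k hf hg hk
    exact cw.comp (hf.prodMk (hg.prodMk hk))
  have cL : Continuous fun s : ℝ =>
      ((a ^ 2 + b ^ 2) - s ^ 2 * lam) * (∫ y in (0:ℝ)..1, ∫ x in (0:ℝ)..y,
        w (h s x y) * (S a x * S b y - S b x * S a y)) := by
    refine Continuous.mul (by fun_prop) ?_
    apply intervalIntegral.continuous_parametric_intervalIntegral_of_continuous'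
    refine intervalIntegral.continuous_parametric_intervalIntegral_of_continuous
      (X := ℝ × ℝ) (f := fun q x => w (h q.1 x q.2) * (S a x * S b q.2 - S b x * S a q.2))
      (s := fun q => q.2) ?_ continuous_snd
    refine Continuous.mul (cwc (fun q : (ℝ × ℝ) × ℝ => q.1.1) (fun q => q.2) (fun q => q.1.2)
      (by fun_prop) (by fun_prop) (by fun_prop)) ?_
    fun_prop
  have cR : Continuous fun s : ℝ =>
      (∫ y in (0:ℝ)..1, (w (h s 0 y) * (a * C a 0 * S b y - b * C b 0 * S a y)
        - w (h s y y) * (a * C a y * S b y - b * C b y * S a y))) +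
      ∫ x in (0:ℝ)..1, (w (h s x x) * (S a x * (b * C b x) - S b x * (a * C a x))
        - w (h s x 1) * (S a x * (b * C b 1) - S b x * (a * C a 1))) := by
    have A1 := cwc (fun q : ℝ × ℝ => q.1) (fun q => 0) (fun q => q.2)
      (by fun_prop) (by fun_prop) (by fun_prop)
    have A2 := cwc (fun q : ℝ × ℝ => q.1) (fun q => q.2) (fun q => q.2)
      (by fun_prop) (by fun_prop) (by fun_prop)
    have A3 := cwc (fun q : ℝ × ℝ => q.1) (fun q => q.2) (fun q => 1)
      (by fun_prop) (by fun_prop) (by fun_prop)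
    refine Continuous.add ?_ ?_
    · apply intervalIntegral.continuous_parametric_intervalIntegral_of_continuous'
      exact (A1.mul (by fun_prop)).sub (A2.mul (by fun_prop))
    · apply intervalIntegral.continuous_parametric_intervalIntegral_of_continuous'
      exact (A2.mul (by fun_prop)).sub (A3.mul (by fun_prop))
  have fin := (Set.EqOn.closure key cL cR)
  rw [closure_Ioo (by norm_num)] at fin
  have f1 := fin (right_mem_Icc.2 zero_le_one)
  have hh1 : ∀ x y, h 1 x y = (x, y) := by intro x y; simp [hh]
  have z1 : ∀ y, w (0, y) = 0 := fun y => h0 _ (fun hp => lt_irrefl _ hp.1)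
  have z2 : ∀ y, w (y, y) = 0 := fun y => h0 _ (fun hp => lt_irrefl _ hp.2.1)
  have z3 : ∀ y, w (y, 1) = 0 := fun y => h0 _ (fun hp => lt_irrefl _ hp.2.2)
  simp only [hh1, z1, z2, z3] at f1
  simpa using f1

lemma square_zero (w : ℝ × ℝ → ℝ) (hc : Continuous w)
    (h0 : ∀ p, p ∉ rightIsoscelesTriangle → w p = 0)
    (H : ∀ j k : ℕ, 0 < j → j < k → ∫ y in (0:ℝ)..1, ∫ x in (0:ℝ)..y,
      w (x, y) * (Real.sin (j * Real.pi * x) * Real.sin (k * Real.pi * y) -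
        Real.sin (k * Real.pi * x) * Real.sin (j * Real.pi * y)) = 0) :
    ∀ p, w p = 0 := by
  have H2 : ∀ j k : ℕ, 0 < j → j < k → ∫ y in (0:ℝ)..1, ∫ x in (0:ℝ)..1,
      w (x, y) * (Real.sin (j * Real.pi * x) * Real.sin (k * Real.pi * y) -
        Real.sin (k * Real.pi * x) * Real.sin (j * Real.pi * y)) = 0 := by
    intro j k hj hk
    refine Eq.trans ?_ (H j k hj hk)
    apply intervalIntegral.integral_congr
    intro y hy
    rw [uIcc_of_le zero_le_one] at hy
    simp only
    rw [← intervalIntegral.integral_add_adjacent_intervals (a := 0) (b := y) (c := 1)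
      (Continuous.intervalIntegrable (by fun_prop) _ _)
      (Continuous.intervalIntegrable (by fun_prop) _ _), add_eq_left,
      ← intervalIntegral.integral_zero (a := y) (b := 1)]
    apply intervalIntegral.integral_congr
    intro x hx
    rw [uIcc_of_le hy.2] at hx
    simp only
    rw [h0 (x, y) (fun hp => absurd hp.2.1 (not_lt.2 hx.1)), zero_mul]
  have H3 : ∀ j k : ℕ, 0 < j → 0 < k → ∫ y in (0:ℝ)..1, ∫ x in (0:ℝ)..1,
      w (x, y) * (Real.sin (j * Real.pi * x) * Real.sin (k * Real.pi * y) -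
        Real.sin (k * Real.pi * x) * Real.sin (j * Real.pi * y)) = 0 := by
    intro j k hj hk
    rcases lt_trichotomy j k with hjk | rfl | hjk
    · exact H2 j k hj hjk
    · simp
    · have := H2 k j hk hjk
      rw [← neg_eq_zero, ← intervalIntegral.integral_neg]
      simp_rw [← intervalIntegral.integral_neg]
      refine Eq.trans ?_ this
      congr 1; ext y; congr 1; ext x; ring
  have H4 : ∀ j k : ℕ, 0 < j → 0 < k → ∫ y in (0:ℝ)..1, (∫ x in (0:ℝ)..1,
      (w (x, y) - w (y, x)) * Real.sin (j * Real.pi * x)) * Real.sin (k * Real.pi * y) = 0 := by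
    intro j k hj hk
    have cA : Continuous fun y : ℝ => ∫ x in (0:ℝ)..1,
        w (x, y) * (Real.sin (j * Real.pi * x) * Real.sin (k * Real.pi * y)) := by
      apply intervalIntegral.continuous_parametric_intervalIntegral_of_continuous'
      fun_prop
    have cB : Continuous fun y : ℝ => ∫ x in (0:ℝ)..1,
        w (y, x) * (Real.sin (j * Real.pi * x) * Real.sin (k * Real.pi * y)) := by
      apply intervalIntegral.continuous_parametric_intervalIntegral_of_continuous'
      fun_prop
    have cD : Continuous fun y : ℝ => ∫ x in (0:ℝ)..1,
        w (x, y) * (Real.sin (k * Real.pi * x) * Real.sin (j * Real.pi * y)) := by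
      apply intervalIntegral.continuous_parametric_intervalIntegral_of_continuous'
      fun_prop
    have e1 : ∀ y : ℝ, (∫ x in (0:ℝ)..1,
      (w (x, y) - w (y, x)) * Real.sin (j * Real.pi * x)) * Real.sin (k * Real.pi * y) =
      (∫ x in (0:ℝ)..1, w (x, y) * (Real.sin (j * Real.pi * x) * Real.sin (k * Real.pi * y))) -
      ∫ x in (0:ℝ)..1, w (y, x) * (Real.sin (j * Real.pi * x) * Real.sin (k * Real.pi * y)) := by
      intro y
      rw [← intervalIntegral.integral_mul_const, ← intervalIntegral.integral_sub
        (Continuous.intervalIntegrable (by fun_prop) _ _)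
        (Continuous.intervalIntegrable (by fun_prop) _ _)]
      congr 1; ext x; ring
    have e2 : ∀ y : ℝ, ∫ x in (0:ℝ)..1,
      w (x, y) * (Real.sin (j * Real.pi * x) * Real.sin (k * Real.pi * y) -
        Real.sin (k * Real.pi * x) * Real.sin (j * Real.pi * y)) =
      (∫ x in (0:ℝ)..1, w (x, y) * (Real.sin (j * Real.pi * x) * Real.sin (k * Real.pi * y))) -
      ∫ x in (0:ℝ)..1, w (x, y) * (Real.sin (k * Real.pi * x) * Real.sin (j * Real.pi * y)) := by
      intro y
      rw [← intervalIntegral.integral_sub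
        (Continuous.intervalIntegrable (by fun_prop) _ _)
        (Continuous.intervalIntegrable (by fun_prop) _ _)]
      congr 1; ext x; ring
    have H3' := H3 j k hj hk
    simp_rw [e2] at H3'
    simp_rw [e1]
    rw [intervalIntegral.integral_sub (cA.intervalIntegrable _ _) (cD.intervalIntegrable _ _)]
      at H3'
    rw [intervalIntegral.integral_sub (cA.intervalIntegrable _ _) (cB.intervalIntegrable _ _)]
    refine Eq.trans ?_ H3'
    congr 1
    rw [intervalIntegral_intervalIntegral_swap]
    · congr 1; ext y; congr 1; ext x; ring
    · refine IntegrableOn.mono_set (t := Icc 0 1 ×ˢ Icc 0 1) ?_ ?_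
      · apply ContinuousOn.integrableOn_compact (isCompact_Icc.prod isCompact_Icc)
        apply Continuous.continuousOn
        unfold Function.uncurry
        fun_prop
      · rw [uIoc_of_le zero_le_one]
        exact Set.prod_mono Ioc_subset_Icc_self Ioc_subset_Icc_self
  have H5 : ∀ j : ℕ, 0 < j → ∀ y ∈ Ioo (0:ℝ) 1, ∫ x in (0:ℝ)..1,
      (w (x, y) - w (y, x)) * Real.sin (j * Real.pi * x) = 0 := by
    intro j hj
    refine sin_complete _ ?_ (fun k hk => H4 j k hj hk)
    apply intervalIntegral.continuous_parametric_intervalIntegral_of_continuous'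
    fun_prop
  have H6 : ∀ y ∈ Ioo (0:ℝ) 1, ∀ x ∈ Ioo (0:ℝ) 1, w (x, y) - w (y, x) = 0 := by
    intro y hy
    exact sin_complete (fun x => w (x, y) - w (y, x)) (by fun_prop) (fun j hj => H5 j hj y hy)
  rintro ⟨x, y⟩
  by_cases hp : (x, y) ∈ rightIsoscelesTriangle
  · obtain ⟨q1, q2, q3⟩ := hp
    simp only at q1 q2 q3
    have := H6 y ⟨by linarith, q3⟩ x ⟨q1, by linarith⟩
    rwa [h0 (y, x) (fun h => lt_asymm h.2.1 q2), sub_zero] at this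
  · exact h0 _ hp

theorem stmt1 (lam : ℝ) (u : ℝ × ℝ → ℝ)
    (hu_cont : ContinuousOn u (closure rightIsoscelesTriangle))
    (hu_smooth : ContDiffOn ℝ 2 u rightIsoscelesTriangle)
    (hu_bdry : ∀ p ∈ frontier rightIsoscelesTriangle, u p = 0)
    (hu_ne : ∃ p ∈ rightIsoscelesTriangle, u p ≠ 0)
    (hu_eq : ∀ p ∈ rightIsoscelesTriangle, lap2 u p = -lam * u p) :
    ∃ j k : ℕ, 0 < j ∧ j < k ∧ lam = Real.pi ^ 2 * ((j : ℝ) ^ 2 + (k : ℝ) ^ 2) := by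
  by_contra! hcon
  obtain ⟨p, hp, hne⟩ := hu_ne
  set w := rightIsoscelesTriangle.indicator u with hw
  have hc : Continuous w := continuous_indicator hu_bdry hu_cont
  have h0 : ∀ p, p ∉ rightIsoscelesTriangle → w p = 0 := fun p hp => indicator_of_notMem hp u
  have heq : ∀ p ∈ rightIsoscelesTriangle, w p = u p := fun p hp => indicator_of_mem hp u
  have hsm : ContDiffOn ℝ 2 w rightIsoscelesTriangle := hu_smooth.congr heq
  have hlap : ∀ p ∈ rightIsoscelesTriangle, lap2 w p = -lam * w p := by
    rintro ⟨x, y⟩ hp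
    rw [heq _ hp, ← hu_eq _ hp]
    unfold lap2
    have t1 : (fun t => w (t, y)) =ᶠ[nhds x] fun t => u (t, y) := by
      have : ∀ᶠ t in nhds x, (t, y) ∈ rightIsoscelesTriangle :=
        (isOpen_tri.preimage (f := fun t : ℝ => (t, y)) (by fun_prop)).mem_nhds hp
      filter_upwards [this] with t ht using heq _ ht
    have t2 : (fun t => w (x, t)) =ᶠ[nhds y] fun t => u (x, t) := by
      have : ∀ᶠ t in nhds y, (x, t) ∈ rightIsoscelesTriangle :=
        (isOpen_tri.preimage (f := fun t : ℝ => (x, t)) (by fun_prop)).mem_nhds hp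
      filter_upwards [this] with t ht using heq _ ht
    simp only
    rw [t1.deriv.deriv_eq, t2.deriv.deriv_eq]
  apply hne
  rw [← heq p hp]
  refine square_zero w hc h0 ?_ p
  intro j k hj hk
  have := ortho lam w hc h0 hsm hlap (j * Real.pi) (k * Real.pi)
    (Real.sin_nat_mul_pi j) (Real.sin_nat_mul_pi k)
  refine (mul_eq_zero.1 this).resolve_left ?_
  intro h
  apply hcon j k hj hk
  linear_combination -h
end

section
/- Every Dirichlet eigenvalue of the equilateral triangle of side 1 is also a Dirichlet eigenvalue of the regular hexagon of side 1: if λ is a Dirichlet eigenvalue of the open triangle with vertices (0,0), (1,0), (1/2, √3/2), then λ is a Dirichlet eigenvalue of the open regular hexagon H whose vertices are (cos(kπ/3), sin(kπ/3)) for k = 0,1,2,3,4,5 (the Dirichlet eigenfunctions extend by odd reflections across the edges of the triangular tiling of the hexagon). -/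
/-- `lam` is a Dirichlet eigenvalue of the bounded open set `Ω ⊆ ℝ²`. -/
def IsDirichletEigenvalue (Ω : Set (ℝ × ℝ)) (lam : ℝ) : Prop :=
  ∃ u : ℝ × ℝ → ℝ,
    ContinuousOn u (closure Ω) ∧
    ContDiffOn ℝ 2 u Ω ∧
    (∀ p ∈ frontier Ω, u p = 0) ∧
    (∃ p ∈ Ω, u p ≠ 0) ∧
    (∀ p ∈ Ω, lap2 u p = -lam * u p)

/-- The open equilateral triangle with vertices `(0,0)`, `(1,0)`, `(1/2, √3/2)`. -/
noncomputable def equilateralTriangle : Set (ℝ × ℝ) :=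
  interior (convexHull ℝ {((0 : ℝ), (0 : ℝ)), ((1 : ℝ), (0 : ℝ)),
    ((1 / 2 : ℝ), (Real.sqrt 3 / 2 : ℝ))})

/-- The open regular hexagon with vertices `(cos(kπ/3), sin(kπ/3))`, `k = 0,…,5`. -/
noncomputable def regularHexagon : Set (ℝ × ℝ) :=
  interior (convexHull ℝ (Set.range fun k : Fin 6 =>
    ((Real.cos (k * Real.pi / 3), Real.sin (k * Real.pi / 3)) : ℝ × ℝ)))


open MeasureTheory Set Filter Topology

namespace Lame

/-- plane wave -/
noncomputable def kk (a b c : ℤ) (p : ℝ × ℝ) : ℂ :=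
  Complex.exp (Complex.I * ((2 * Real.pi / 3 * (a * (2 * p.1) + b * (-p.1 + √3 * p.2) +
    c * (-p.1 - √3 * p.2)) : ℝ) : ℂ))

lemma kk_mul (a b c a' b' c' : ℤ) (p : ℝ × ℝ) :
    kk a b c p * kk a' b' c' p = kk (a + a') (b + b') (c + c') p := by
  unfold kk
  rw [← Complex.exp_add]
  congr 1
  push_cast
  ring

lemma kk_conj (a b c : ℤ) (p : ℝ × ℝ) :
    (starRingEnd ℂ) (kk a b c p) = kk (-a) (-b) (-c) p := by
  unfold kk
  rw [← Complex.exp_conj, map_mul, Complex.conj_I, Complex.conj_ofReal]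
  congr 1
  push_cast
  ring

lemma kk_cont (a b c : ℤ) : Continuous (kk a b c) := by
  unfold kk
  fun_prop

lemma kk_smooth (a b c : ℤ) : ContDiff ℝ 2 (kk a b c) := by
  unfold kk
  have h : ContDiff ℝ 2 (fun p : ℝ × ℝ => (2 * Real.pi / 3 * (a * (2 * p.1) +
    b * (-p.1 + √3 * p.2) + c * (-p.1 - √3 * p.2)) : ℝ)) := by fun_prop
  have h2 := Complex.ofRealCLM.contDiff.comp h
  exact (contDiff_const.mul h2).cexp

noncomputable def ax (a b c : ℤ) : ℂ := Complex.I * (2 * Real.pi / 3 * (2 * a - b - c))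
noncomputable def ay (_a b c : ℤ) : ℂ := Complex.I * (2 * Real.pi / 3 * (√3 : ℝ) * (b - c))

lemma kk_dx (a b c : ℤ) (x y : ℝ) :
    HasDerivAt (fun x => kk a b c (x, y)) (ax a b c * kk a b c (x, y)) x := by
  unfold kk ax
  have h : HasDerivAt (fun x : ℝ => (2 * Real.pi / 3 * (a * (2 * x) + b * (-x + √3 * y) +
    c * (-x - √3 * y)) : ℝ)) (2 * Real.pi / 3 * (a * (2 * 1) + b * (-1) + c * (-1))) x := by
    have h0 := hasDerivAt_id' x
    exact ((((h0.const_mul 2).const_mul (a : ℝ)).add ((h0.neg.add_const _).const_mul (b : ℝ))).add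
      ((h0.neg.sub_const _).const_mul (c : ℝ))).const_mul _
  have h2 := (h.ofReal_comp.const_mul Complex.I).cexp
  convert h2 using 1
  push_cast
  ring

lemma kk_dy (a b c : ℤ) (x y : ℝ) :
    HasDerivAt (fun y => kk a b c (x, y)) (ay a b c * kk a b c (x, y)) y := by
  unfold kk ay
  have h : HasDerivAt (fun y : ℝ => (2 * Real.pi / 3 * (a * (2 * x) + b * (-x + √3 * y) +
    c * (-x - √3 * y)) : ℝ)) (2 * Real.pi / 3 * (b * (√3 * 1) + c * (-(√3 * 1)))) y := by
    have h0 := (hasDerivAt_id' y).const_mul √3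
    exact (((h0.const_add _).const_mul (b : ℝ)).const_add _ |>.add
      ((h0.const_sub _).const_mul (c : ℝ))).const_mul _
  have h2 := (h.ofReal_comp.const_mul Complex.I).cexp
  convert h2 using 1
  push_cast
  ring

lemma sq3 : ((√3 : ℝ) : ℂ) ^ 2 = 3 := by
  rw [← Complex.ofReal_pow, Real.sq_sqrt (by norm_num)]; norm_num

noncomputable def mu (a b c : ℤ) : ℝ :=
  16 * Real.pi ^ 2 / 9 * (a ^ 2 + b ^ 2 + c ^ 2 - a * b - b * c - a * c)

lemma ax_ay (a b c : ℤ) : ax a b c ^ 2 + ay a b c ^ 2 = - (mu a b c : ℂ) := by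
  unfold ax ay mu
  have h := sq3
  have hI := Complex.I_sq
  simp only [mul_pow, hI, h]
  push_cast
  ring

/-- weighted antisymmetric sums -/
noncomputable def asum (f : ℤ → ℤ → ℤ → ℂ) (a b c : ℤ) (p : ℝ × ℝ) : ℂ :=
  f a b c * kk a b c p + f b c a * kk b c a p + f c a b * kk c a b p
  - f b a c * kk b a c p - f a c b * kk a c b p - f c b a * kk c b a p

lemma asum_cont (f) (a b c : ℤ) : Continuous (asum f a b c) := by
  unfold asum
  have := kk_cont
  fun_prop

lemma asum_smooth (f) (a b c : ℤ) : ContDiff ℝ 2 (asum f a b c) := by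
  unfold asum
  have := kk_smooth
  fun_prop

lemma asum_dx (f) (a b c : ℤ) (x y : ℝ) :
    HasDerivAt (fun x => asum f a b c (x, y))
      (asum (fun a b c => ax a b c * f a b c) a b c (x, y)) x := by
  unfold asum
  have h := fun a b c => (kk_dx a b c x y).const_mul (f a b c)
  exact ((((((h a b c).add (h b c a)).add (h c a b)).sub (h b a c)).sub (h a c b)).sub
    (h c b a)).congr_deriv (by ring)

lemma asum_dy (f) (a b c : ℤ) (x y : ℝ) :
    HasDerivAt (fun y => asum f a b c (x, y))
      (asum (fun a b c => ay a b c * f a b c) a b c (x, y)) y := by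
  unfold asum
  have h := fun a b c => (kk_dy a b c x y).const_mul (f a b c)
  exact ((((((h a b c).add (h b c a)).add (h c a b)).sub (h b a c)).sub (h a c b)).sub
    (h c b a)).congr_deriv (by ring)

/-- the Lamé function -/
noncomputable def AA (a b c : ℤ) : ℝ × ℝ → ℂ := asum (fun _ _ _ => 1) a b c
noncomputable def Ax (a b c : ℤ) : ℝ × ℝ → ℂ := asum (fun a b c => ax a b c * 1) a b c
noncomputable def Ay (a b c : ℤ) : ℝ × ℝ → ℂ := asum (fun a b c => ay a b c * 1) a b c
noncomputable def Axx (a b c : ℤ) : ℝ × ℝ → ℂ :=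
  asum (fun a b c => ax a b c * (ax a b c * 1)) a b c
noncomputable def Ayy (a b c : ℤ) : ℝ × ℝ → ℂ :=
  asum (fun a b c => ay a b c * (ay a b c * 1)) a b c

lemma AA_lap (a b c : ℤ) (p : ℝ × ℝ) :
    Axx a b c p + Ayy a b c p = - (mu a b c : ℂ) * AA a b c p := by
  have h := ax_ay
  have h1 : mu b c a = mu a b c := by unfold mu; ring
  have h2 : mu c a b = mu a b c := by unfold mu; ring
  have h3 : mu b a c = mu a b c := by unfold mu; ring
  have h4 : mu a c b = mu a b c := by unfold mu; ring
  have h5 : mu c b a = mu a b c := by unfold mu; ring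
  have g0 := h a b c
  have g1 := h b c a
  have g2 := h c a b
  have g3 := h b a c
  have g4 := h a c b
  have g5 := h c b a
  rw [h1] at g1; rw [h2] at g2; rw [h3] at g3; rw [h4] at g4; rw [h5] at g5
  unfold Axx Ayy AA asum
  linear_combination kk a b c p * g0 + kk b c a p * g1 + kk c a b p * g2 - kk b a c p * g3
    - kk a c b p * g4 - kk c b a p * g5

lemma kk_split (a b c : ℤ) (p : ℝ × ℝ) :
    kk a b c p = kk a 0 0 p * kk 0 b 0 p * kk 0 0 c p := by
  simp [kk_mul]

/-- exponentials agree if the phases differ by an integer number of turns -/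
lemma kk_eq_of (a b c a' b' c' : ℤ) (p : ℝ × ℝ) (n : ℤ)
    (h : (a * (2 * p.1) + b * (-p.1 + √3 * p.2) + c * (-p.1 - √3 * p.2)) =
      (a' * (2 * p.1) + b' * (-p.1 + √3 * p.2) + c' * (-p.1 - √3 * p.2)) + 3 * n) :
    kk a b c p = kk a' b' c' p := by
  unfold kk
  rw [Complex.exp_eq_exp_iff_exists_int]
  refine ⟨n, ?_⟩
  rw [h]
  push_cast
  ring

lemma of_kk_eq (a b c a' b' c' : ℤ) (p q : ℝ × ℝ)
    (h : kk a b c p = kk a' b' c' q) : ∃ n : ℤ,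
    (a * (2 * p.1) + b * (-p.1 + √3 * p.2) + c * (-p.1 - √3 * p.2)) =
      (a' * (2 * q.1) + b' * (-q.1 + √3 * q.2) + c' * (-q.1 - √3 * q.2)) + 3 * n := by
  unfold kk at h
  rw [Complex.exp_eq_exp_iff_exists_int] at h
  obtain ⟨n, hn⟩ := h
  refine ⟨n, ?_⟩
  have h2 : (Complex.I * (2 * Real.pi / 3)) * (((a * (2 * p.1) + b * (-p.1 + √3 * p.2) + c * (-p.1 - √3 * p.2) : ℝ)) : ℂ) =
    (Complex.I * (2 * Real.pi / 3)) * (((a' * (2 * q.1) + b' * (-q.1 + √3 * q.2) + c' * (-q.1 - √3 * q.2)) + 3 * n : ℝ) : ℂ) := by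
    push_cast at hn ⊢
    linear_combination hn
  have h3 : Complex.I * (2 * Real.pi / 3) ≠ 0 := by
    have : (Real.pi : ℂ) ≠ 0 := by exact_mod_cast Real.pi_ne_zero
    simp [this]
  exact_mod_cast mul_left_cancel₀ h3 h2

lemma AA_zero1 (a b c n : ℤ) (p : ℝ × ℝ) (h : 3 * p.1 - √3 * p.2 = 3 * n) : AA a b c p = 0 := by
  have key : ∀ m : ℤ, kk m 0 0 p = kk 0 m 0 p := fun m => by
    apply kk_eq_of _ _ _ _ _ _ _ (m * n)
    push_cast
    linear_combination (m : ℝ) * h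
  unfold AA asum
  simp only [kk_split a b c, kk_split b c a, kk_split c a b, kk_split b a c, kk_split a c b,
    kk_split c b a, key]
  ring

lemma AA_zero2 (a b c n : ℤ) (p : ℝ × ℝ) (h : 2 * (√3 * p.2) = 3 * n) : AA a b c p = 0 := by
  have key : ∀ m : ℤ, kk 0 m 0 p = kk 0 0 m p := fun m => by
    apply kk_eq_of _ _ _ _ _ _ _ (m * n)
    push_cast
    linear_combination (m : ℝ) * h
  unfold AA asum
  simp only [kk_split a b c, kk_split b c a, kk_split c a b, kk_split b a c, kk_split a c b,
    kk_split c b a, key]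
  ring

lemma AA_zero3 (a b c n : ℤ) (p : ℝ × ℝ) (h : 3 * p.1 + √3 * p.2 = 3 * n) : AA a b c p = 0 := by
  have key : ∀ m : ℤ, kk m 0 0 p = kk 0 0 m p := fun m => by
    apply kk_eq_of _ _ _ _ _ _ _ (m * n)
    push_cast
    linear_combination (m : ℝ) * h
  unfold AA asum
  simp only [kk_split a b c, kk_split b c a, kk_split c a b, kk_split b a c, kk_split a c b,
    kk_split c b a, key]
  ring

noncomputable def zz (p : ℝ × ℝ) : ℂ := kk 1 0 0 p + kk 0 1 0 p + kk 0 0 1 p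

lemma zz_mul (a b c : ℤ) (p : ℝ × ℝ) :
    zz p * AA a b c p = AA (a + 1) b c p + AA a (b + 1) c p + AA a b (c + 1) p := by
  have h1 : ∀ a b c, kk 1 0 0 p * kk a b c p = kk (a + 1) b c p := fun a b c => by
    rw [kk_mul]; simp [add_comm]
  have h2 : ∀ a b c, kk 0 1 0 p * kk a b c p = kk a (b + 1) c p := fun a b c => by
    rw [kk_mul]; simp [add_comm]
  have h3 : ∀ a b c, kk 0 0 1 p * kk a b c p = kk a b (c + 1) p := fun a b c => by
    rw [kk_mul]; simp [add_comm]
  unfold zz AA asum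
  simp only [add_mul, mul_add, mul_sub, one_mul, h1, h2, h3]
  ring

lemma zz_conj_mul (a b c : ℤ) (p : ℝ × ℝ) :
    (starRingEnd ℂ) (zz p) * AA a b c p =
      AA (a - 1) b c p + AA a (b - 1) c p + AA a b (c - 1) p := by
  have h1 : ∀ a b c, kk (-1) 0 0 p * kk a b c p = kk (a - 1) b c p := fun a b c => by
    rw [kk_mul]; congr 1 <;> ring
  have h2 : ∀ a b c, kk 0 (-1) 0 p * kk a b c p = kk a (b - 1) c p := fun a b c => by
    rw [kk_mul]; congr 1 <;> ring
  have h3 : ∀ a b c, kk 0 0 (-1) p * kk a b c p = kk a b (c - 1) p := fun a b c => by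
    rw [kk_mul]; congr 1 <;> ring
  unfold zz AA asum
  simp only [map_add, kk_conj, neg_zero, add_mul, mul_add, mul_sub, one_mul, h1, h2, h3]
  ring

lemma kk_zero (p) : kk 0 0 0 p = 1 := by simp [kk]

lemma kk_111 (p) : kk 1 1 1 p = 1 := by
  rw [← kk_zero p]
  apply kk_eq_of _ _ _ _ _ _ _ 0
  push_cast; ring

lemma AA_vander (p : ℝ × ℝ) : AA 0 1 2 p =
    (kk 0 1 0 p - kk 1 0 0 p) * (kk 0 0 1 p - kk 1 0 0 p) * (kk 0 0 1 p - kk 0 1 0 p) := by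
  unfold AA asum
  have e1 : kk 2 0 0 p = kk 1 0 0 p ^ 2 := by rw [sq, kk_mul]; rfl
  have e2 : kk 0 2 0 p = kk 0 1 0 p ^ 2 := by rw [sq, kk_mul]; rfl
  have e3 : kk 0 0 2 p = kk 0 0 1 p ^ 2 := by rw [sq, kk_mul]; rfl
  simp only [kk_split 0 1 2, kk_split 1 2 0, kk_split 2 0 1, kk_split 1 0 2, kk_split 0 2 1,
    kk_split 2 1 0, kk_zero, e1, e2, e3]
  ring

/-- closed and open triangle by inequalities -/
def CT : Set (ℝ × ℝ) := {p | 0 ≤ p.2 ∧ p.2 ≤ √3 * p.1 ∧ p.2 ≤ √3 * (1 - p.1)}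
def OT : Set (ℝ × ℝ) := {p | 0 < p.2 ∧ p.2 < √3 * p.1 ∧ p.2 < √3 * (1 - p.1)}

lemma s3 : √3 * √3 = 3 := Real.mul_self_sqrt (by norm_num)
lemma s3pos : 0 < √3 := by positivity

lemma CT_ineq {p : ℝ × ℝ} (hp : p ∈ CT) :
    0 ≤ √3 * p.2 ∧ √3 * p.2 ≤ 3 * p.1 ∧ √3 * p.2 ≤ 3 * (1 - p.1) := by
  obtain ⟨h1, h2, h3⟩ := hp
  have := s3; have := s3pos
  refine ⟨by positivity, by nlinarith, by nlinarith⟩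

lemma OT_ineq {p : ℝ × ℝ} (hp : p ∈ OT) :
    0 < √3 * p.2 ∧ √3 * p.2 < 3 * p.1 ∧ √3 * p.2 < 3 * (1 - p.1) := by
  obtain ⟨h1, h2, h3⟩ := hp
  have := s3; have := s3pos
  refine ⟨by positivity, by nlinarith, by nlinarith⟩

lemma AA_ne (p : ℝ × ℝ) (hp : p ∈ OT) : AA 0 1 2 p ≠ 0 := by
  obtain ⟨h1, h2, h3⟩ := OT_ineq hp
  rw [AA_vander]
  refine mul_ne_zero (mul_ne_zero ?_ ?_) ?_
  all_goals
    intro h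
    obtain ⟨n, hn⟩ := of_kk_eq _ _ _ _ _ _ _ _ (sub_eq_zero.1 h)
    push_cast at hn
    have l1 : (n : ℝ) < 0 := by linarith
    have l2 : (-1 : ℝ) < n := by linarith
    have l1' : n < 0 := by exact_mod_cast l1
    have l2' : -1 < n := by exact_mod_cast l2
    omega

lemma cubic_roots {a b c a' b' c' : ℂ} (h1 : a + b + c = a' + b' + c')
    (h2 : a * b + b * c + c * a = a' * b' + b' * c' + c' * a') (h3 : a * b * c = a' * b' * c') :
    (a = a' ∧ b = b' ∧ c = c') ∨ (a = a' ∧ b = c' ∧ c = b') ∨ (a = b' ∧ b = a' ∧ c = c') ∨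
    (a = b' ∧ b = c' ∧ c = a') ∨ (a = c' ∧ b = a' ∧ c = b') ∨ (a = c' ∧ b = b' ∧ c = a') := by
  have two : ∀ {x y x' y' : ℂ}, x + y = x' + y' → x * y = x' * y' →
      (x = x' ∧ y = y') ∨ (x = y' ∧ y = x') := by
    intro x y x' y' e1 e2
    have : (x - x') * (x - y') = 0 := by linear_combination x * e1 - e2
    rcases mul_eq_zero.1 this with h | h
    · left; have := sub_eq_zero.1 h; subst this; exact ⟨rfl, by linear_combination e1⟩
    · right; have := sub_eq_zero.1 h; subst this; exact ⟨rfl, by linear_combination e1⟩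
  have key : (a - a') * (a - b') * (a - c') = 0 := by
    linear_combination a ^ 2 * h1 - a * h2 + h3
  have aux : ∀ {x y z y' z' : ℂ}, x + y + z = x + y' + z' →
     x * y + y * z + z * x = x * y' + y' * z' + z' * x → y + z = y' + z' ∧ y * z = y' * z' := by
    intro x y z y' z' e1 e2
    exact ⟨by linear_combination e1, by linear_combination e2 - x * e1⟩
  rcases mul_eq_zero.1 key with h | h
  · rcases mul_eq_zero.1 h with h | h
    · have e := sub_eq_zero.1 h; subst e
      obtain ⟨f1, f2⟩ := aux h1 h2
      rcases two f1 f2 with ⟨g1, g2⟩ | ⟨g1, g2⟩ <;> simp [g1, g2]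
    · have e := sub_eq_zero.1 h; subst e
      obtain ⟨f1, f2⟩ := aux (x := a) (y := b) (z := c) (y' := a') (z' := c')
        (by linear_combination h1) (by linear_combination h2)
      rcases two f1 f2 with ⟨g1, g2⟩ | ⟨g1, g2⟩ <;> simp [g1, g2]
  · have e := sub_eq_zero.1 h; subst e
    obtain ⟨f1, f2⟩ := aux (x := a) (y := b) (z := c) (y' := a') (z' := b')
      (by linear_combination h1) (by linear_combination h2)
    rcases two f1 f2 with ⟨g1, g2⟩ | ⟨g1, g2⟩ <;> simp [g1, g2]

lemma zz_e2 (p : ℝ × ℝ) : kk 1 0 0 p * kk 0 1 0 p + kk 0 1 0 p * kk 0 0 1 p +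
    kk 0 0 1 p * kk 1 0 0 p = (starRingEnd ℂ) (zz p) := by
  have h1 : kk 0 0 (-1) p = kk 1 1 0 p := by
    apply kk_eq_of _ _ _ _ _ _ _ 0; push_cast; ring
  have h2 : kk 0 (-1) 0 p = kk 1 0 1 p := by
    apply kk_eq_of _ _ _ _ _ _ _ 0; push_cast; ring
  have h3 : kk (-1) 0 0 p = kk 0 1 1 p := by
    apply kk_eq_of _ _ _ _ _ _ _ 0; push_cast; ring
  unfold zz
  simp only [map_add, kk_conj, kk_mul, neg_zero, h1, h2, h3]
  norm_num
  ring

set_option maxHeartbeats 4000000 in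
lemma alcove (n k l : ℤ) (t1 t2 t3 r1 r2 r3 : ℝ) (ht : t1 + t2 + t3 = 0) (hr : r1 + r2 + r3 = 0)
    (a1 : t2 ≤ t1) (a2 : t3 ≤ t2) (a3 : t1 ≤ t3 + 3)
    (b1 : r2 ≤ r1) (b2 : r3 ≤ r2) (b3 : r1 ≤ r3 + 3)
    (h : (t1 = r1 + 3 * n ∧ t2 = r2 + 3 * k ∧ t3 = r3 + 3 * l) ∨
     (t1 = r1 + 3 * n ∧ t2 = r3 + 3 * k ∧ t3 = r2 + 3 * l) ∨
     (t1 = r2 + 3 * n ∧ t2 = r1 + 3 * k ∧ t3 = r3 + 3 * l) ∨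
     (t1 = r2 + 3 * n ∧ t2 = r3 + 3 * k ∧ t3 = r1 + 3 * l) ∨
     (t1 = r3 + 3 * n ∧ t2 = r1 + 3 * k ∧ t3 = r2 + 3 * l) ∨
     (t1 = r3 + 3 * n ∧ t2 = r2 + 3 * k ∧ t3 = r1 + 3 * l)) : t1 = r1 ∧ t2 = r2 ∧ t3 = r3 := by
  have hs : (n : ℝ) + k + l = 0 := by
    rcases h with h | h | h | h | h | h <;> obtain ⟨e1, e2, e3⟩ := h <;> linarith
  have bn : (n : ℝ) < 2 ∧ -2 < (n : ℝ) ∧ (k : ℝ) < 2 ∧ -2 < (k : ℝ) := by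
    rcases h with h | h | h | h | h | h <;> obtain ⟨e1, e2, e3⟩ := h <;>
    refine ⟨?_, ?_, ?_, ?_⟩ <;> linarith
  obtain ⟨c1, c2, c3, c4⟩ := bn
  have c1' : n < 2 := by exact_mod_cast c1
  have c2' : -2 < n := by exact_mod_cast c2
  have c3' : k < 2 := by exact_mod_cast c3
  have c4' : -2 < k := by exact_mod_cast c4
  have hl : (l : ℝ) = - n - k := by linarith
  rw [hl] at h
  clear hs hl c1 c2 c3 c4
  interval_cases n <;> interval_cases k <;> push_cast at h <;>
  rcases h with h | h | h | h | h | h <;> obtain ⟨e1, e2, e3⟩ := h <;>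
  refine ⟨?_, ?_, ?_⟩ <;> linarith

lemma zz_inj {p q : ℝ × ℝ} (hp : p ∈ CT) (hq : q ∈ CT) (h : zz p = zz q) : p = q := by
  have h2 := congrArg (starRingEnd ℂ) h
  rw [← zz_e2, ← zz_e2] at h2
  have e : ∀ p, kk 1 0 0 p * kk 0 1 0 p * kk 0 0 1 p = 1 := fun p => by
    rw [← kk_split, kk_111]
  have h3 := (e p).trans (e q).symm
  obtain ⟨h1p, h2p, h3p⟩ := CT_ineq hp
  obtain ⟨h1q, h2q, h3q⟩ := CT_ineq hq
  have hr := cubic_roots h h2 h3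
  have main : ∃ n k l : ℤ,
     (2 * p.1 = 2 * q.1 + 3 * n ∧ -p.1 + √3 * p.2 = -q.1 + √3 * q.2 + 3 * k ∧ -p.1 - √3 * p.2 = -q.1 - √3 * q.2 + 3 * l) ∨
     (2 * p.1 = 2 * q.1 + 3 * n ∧ -p.1 + √3 * p.2 = -q.1 - √3 * q.2 + 3 * k ∧ -p.1 - √3 * p.2 = -q.1 + √3 * q.2 + 3 * l) ∨
     (2 * p.1 = -q.1 + √3 * q.2 + 3 * n ∧ -p.1 + √3 * p.2 = 2 * q.1 + 3 * k ∧ -p.1 - √3 * p.2 = -q.1 - √3 * q.2 + 3 * l) ∨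
     (2 * p.1 = -q.1 + √3 * q.2 + 3 * n ∧ -p.1 + √3 * p.2 = -q.1 - √3 * q.2 + 3 * k ∧ -p.1 - √3 * p.2 = 2 * q.1 + 3 * l) ∨
     (2 * p.1 = -q.1 - √3 * q.2 + 3 * n ∧ -p.1 + √3 * p.2 = 2 * q.1 + 3 * k ∧ -p.1 - √3 * p.2 = -q.1 + √3 * q.2 + 3 * l) ∨
     (2 * p.1 = -q.1 - √3 * q.2 + 3 * n ∧ -p.1 + √3 * p.2 = -q.1 + √3 * q.2 + 3 * k ∧ -p.1 - √3 * p.2 = 2 * q.1 + 3 * l) := by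
    rcases hr with h | h | h | h | h | h <;> obtain ⟨e1, e2, e3⟩ := h <;>
    obtain ⟨n, hn⟩ := of_kk_eq _ _ _ _ _ _ _ _ e1 <;>
    obtain ⟨k, hk⟩ := of_kk_eq _ _ _ _ _ _ _ _ e2 <;>
    obtain ⟨l, hl⟩ := of_kk_eq _ _ _ _ _ _ _ _ e3 <;>
    refine ⟨n, k, l, ?_⟩ <;>
    simp only [Int.cast_one, Int.cast_zero, one_mul, zero_mul, add_zero, zero_add] at hn hk hl <;>
    simp only [hn, hk, hl, and_self, true_or, or_true]
  obtain ⟨n, k, l, hm⟩ := main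
  obtain ⟨r1, r2, r3⟩ := alcove n k l _ _ _ _ _ _ (by ring) (by ring) (by linarith) (by linarith)
    (by linarith) (by linarith) (by linarith) (by linarith) hm
  have := s3pos
  ext
  · linarith
  · have : √3 * p.2 = √3 * q.2 := by linarith
    exact mul_left_cancel₀ s3pos.ne' this

lemma comb3 {S : Set (ℝ × ℝ)} (hS : Convex ℝ S) {a b c p : ℝ × ℝ} (ha : a ∈ S) (hb : b ∈ S)
    (hc : c ∈ S) (α β γ : ℝ) (h1 : 0 ≤ α) (h2 : 0 ≤ β) (h3 : 0 ≤ γ) (h : α + β + γ = 1)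
    (hp1 : p.1 = α * a.1 + β * b.1 + γ * c.1) (hp2 : p.2 = α * a.2 + β * b.2 + γ * c.2) :
    p ∈ S := by
  have := hS.sum_mem (t := Finset.univ) (w := ![α, β, γ]) (z := ![a, b, c])
    (by intro i _; fin_cases i <;> simpa) (by simpa [Fin.sum_univ_three] using h)
    (by intro i _; fin_cases i <;> simpa)
  convert this
  ext
  · simp [Fin.sum_univ_three, hp1]
  · simp [Fin.sum_univ_three, hp2]

lemma interior_move {C : Set (ℝ × ℝ)} {p : ℝ × ℝ} (hp : p ∈ interior C) (d : ℝ × ℝ) :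
    ∃ s > 0, (p.1 + s * d.1, p.2 + s * d.2) ∈ C := by
  have hc : Continuous (fun s : ℝ => (p.1 + s * d.1, p.2 + s * d.2)) := by fun_prop
  have h1 : ∀ᶠ s in 𝓝 (0 : ℝ), (p.1 + s * d.1, p.2 + s * d.2) ∈ C := by
    apply hc.continuousAt
    simpa using mem_interior_iff_mem_nhds.1 hp
  have h2 : ∀ᶠ s in 𝓝[>] (0 : ℝ), (p.1 + s * d.1, p.2 + s * d.2) ∈ C := h1.filter_mono inf_le_left
  obtain ⟨s, hs, hs0⟩ := (h2.and self_mem_nhdsWithin).exists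
  exact ⟨s, hs0, hs⟩

lemma CT_convex : Convex ℝ CT := by
  rintro ⟨x, y⟩ ⟨h1, h2, h3⟩ ⟨x', y'⟩ ⟨h1', h2', h3'⟩ a b ha hb hab
  simp only [CT, mem_ofPred_eq, Prod.smul_mk, Prod.mk_add_mk, smul_eq_mul] at *
  have hb' : b = 1 - a := by linarith
  refine ⟨by positivity, by nlinarith, ?_⟩
  have := mul_le_mul_of_nonneg_left h3 ha
  have := mul_le_mul_of_nonneg_left h3' hb
  subst hb'
  linarith

lemma CT_closed : IsClosed CT := by
  have h1 : IsClosed {p : ℝ × ℝ | 0 ≤ p.2} := isClosed_le (by fun_prop) (by fun_prop)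
  have h2 : IsClosed {p : ℝ × ℝ | p.2 ≤ √3 * p.1} := isClosed_le (by fun_prop) (by fun_prop)
  have h3 : IsClosed {p : ℝ × ℝ | p.2 ≤ √3 * (1 - p.1)} := isClosed_le (by fun_prop) (by fun_prop)
  exact h1.inter (h2.inter h3)

lemma OT_open : IsOpen OT := by
  have h1 : IsOpen {p : ℝ × ℝ | 0 < p.2} := isOpen_lt (by fun_prop) (by fun_prop)
  have h2 : IsOpen {p : ℝ × ℝ | p.2 < √3 * p.1} := isOpen_lt (by fun_prop) (by fun_prop)
  have h3 : IsOpen {p : ℝ × ℝ | p.2 < √3 * (1 - p.1)} := isOpen_lt (by fun_prop) (by fun_prop)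
  exact h1.inter (h2.inter h3)

lemma OT_sub : OT ⊆ CT := fun _ h => ⟨h.1.le, h.2.1.le, h.2.2.le⟩

lemma s3lt : √3 < 2 := by
  rw [Real.sqrt_lt' (by norm_num)]; norm_num

lemma CT_box {p : ℝ × ℝ} (hp : p ∈ CT) : 0 ≤ p.1 ∧ p.1 ≤ 1 ∧ 0 ≤ p.2 ∧ p.2 ≤ 1 := by
  obtain ⟨h1, h2, h3⟩ := hp
  have := s3pos
  have := s3lt
  refine ⟨?_, ?_, h1, ?_⟩
  · exact nonneg_of_mul_nonneg_right (h1.trans h2) s3pos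
  · have := nonneg_of_mul_nonneg_right (h1.trans h3) s3pos
    linarith
  · nlinarith

lemma CT_compact : IsCompact CT := by
  apply IsCompact.of_isClosed_subset (isCompact_Icc (a := ((0 : ℝ), (0 : ℝ))) (b := (1, 1))) CT_closed
  intro p hp
  obtain ⟨h1, h2, h3, h4⟩ := CT_box hp
  exact ⟨⟨h1, h3⟩, ⟨h2, h4⟩⟩

lemma interior_CT : interior CT = OT := by
  apply Subset.antisymm
  · intro p hp
    refine ⟨?_, ?_, ?_⟩
    · obtain ⟨s, hs, h⟩ := interior_move hp (0, -1)
      have := h.1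
      simp at this; linarith
    · obtain ⟨s, hs, h⟩ := interior_move hp (-1, 0)
      have := h.2.1
      simp only [mul_neg, mul_one, mul_zero, add_zero] at this; nlinarith [mul_pos s3pos hs]
    · obtain ⟨s, hs, h⟩ := interior_move hp (1, 0)
      have := h.2.2
      simp only [mul_one, mul_zero, add_zero] at this; nlinarith [mul_pos s3pos hs]
  · exact interior_maximal OT_sub OT_open

lemma hull_CT : convexHull ℝ {((0 : ℝ), (0 : ℝ)), ((1 : ℝ), (0 : ℝ)),
    ((1 / 2 : ℝ), (√3 / 2 : ℝ))} = CT := by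
  have := s3pos
  have := s3
  apply Subset.antisymm
  · apply convexHull_min _ CT_convex
    rintro p (rfl | rfl | rfl)
    · simp [CT]
    · simp [CT]
    · refine ⟨?_, ?_, ?_⟩ <;> simp <;> linarith
  · intro p hp
    obtain ⟨h1, h2, h3⟩ := CT_ineq hp
    apply comb3 (convex_convexHull ℝ _) (subset_convexHull ℝ _ (by simp : ((0 : ℝ), (0 : ℝ)) ∈ _))
      (subset_convexHull ℝ _ (by simp : ((1 : ℝ), (0 : ℝ)) ∈ _))
      (subset_convexHull ℝ _ (by simp : ((1 / 2 : ℝ), (√3 / 2 : ℝ)) ∈ _))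
      (1 - p.1 - √3 * p.2 / 3) (p.1 - √3 * p.2 / 3) (2 * (√3 * p.2) / 3)
    · linarith
    · linarith
    · linarith
    · ring
    · simp; ring
    · simp; linear_combination (- p.2 / 3) * s3

lemma tri_eq : equilateralTriangle = OT := by
  unfold equilateralTriangle
  rw [hull_CT, interior_CT]

lemma cent_mem : ((1 / 2 : ℝ), (1 / 4 : ℝ)) ∈ OT := by
  have : 1 < √3 := by rw [Real.lt_sqrt] <;> norm_num
  refine ⟨?_, ?_, ?_⟩ <;> simp <;> linarith

lemma closure_OT : closure OT = CT := by
  rw [← interior_CT, CT_convex.closure_interior_eq_closure_of_nonempty_interior, CT_closed.closure_eq]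
  rw [interior_CT]
  exact ⟨_, cent_mem⟩

lemma frontier_OT {p : ℝ × ℝ} (h : p ∈ CT) (h' : p ∉ OT) : p ∈ frontier OT := by
  rw [frontier, closure_OT, OT_open.interior_eq]
  exact ⟨h, h'⟩

/-- hexagon -/
def HC : Set (ℝ × ℝ) := {p | (-3 ≤ 2 * (√3 * p.2) ∧ 2 * (√3 * p.2) ≤ 3) ∧
  (-3 ≤ 3 * p.1 - √3 * p.2 ∧ 3 * p.1 - √3 * p.2 ≤ 3) ∧
  (-3 ≤ 3 * p.1 + √3 * p.2 ∧ 3 * p.1 + √3 * p.2 ≤ 3)}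

lemma HC_convex : Convex ℝ HC := by
  rintro ⟨x, y⟩ ⟨⟨h1, h2⟩, ⟨h3, h4⟩, ⟨h5, h6⟩⟩ ⟨x', y'⟩ ⟨⟨h1', h2'⟩, ⟨h3', h4'⟩, ⟨h5', h6'⟩⟩ a b ha hb hab
  simp only [HC, mem_ofPred_eq, Prod.smul_mk, Prod.mk_add_mk, smul_eq_mul] at *
  have hb' : b = 1 - a := by linarith
  have g1 := mul_le_mul_of_nonneg_left h1 ha
  have g2 := mul_le_mul_of_nonneg_left h2 ha
  have g3 := mul_le_mul_of_nonneg_left h3 ha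
  have g4 := mul_le_mul_of_nonneg_left h4 ha
  have g5 := mul_le_mul_of_nonneg_left h5 ha
  have g6 := mul_le_mul_of_nonneg_left h6 ha
  have k1 := mul_le_mul_of_nonneg_left h1' hb
  have k2 := mul_le_mul_of_nonneg_left h2' hb
  have k3 := mul_le_mul_of_nonneg_left h3' hb
  have k4 := mul_le_mul_of_nonneg_left h4' hb
  have k5 := mul_le_mul_of_nonneg_left h5' hb
  have k6 := mul_le_mul_of_nonneg_left h6' hb
  subst hb'
  refine ⟨⟨?_, ?_⟩, ⟨?_, ?_⟩, ⟨?_, ?_⟩⟩ <;> linarith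

lemma HC_closed : IsClosed HC := by
  have a : ∀ f : ℝ × ℝ → ℝ, Continuous f → IsClosed {p : ℝ × ℝ | -3 ≤ f p ∧ f p ≤ 3} := fun f hf =>
    (isClosed_le continuous_const hf).inter (isClosed_le hf continuous_const)
  exact (a (fun p => 2 * (√3 * p.2)) (by fun_prop)).inter
    ((a (fun p => 3 * p.1 - √3 * p.2) (by fun_prop)).inter
     (a (fun p => 3 * p.1 + √3 * p.2) (by fun_prop)))

lemma hexpts : (Set.range fun k : Fin 6 =>
    ((Real.cos (k * Real.pi / 3), Real.sin (k * Real.pi / 3)) : ℝ × ℝ)) =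
    {(1, 0), (1 / 2, √3 / 2), (-(1 / 2), √3 / 2), (-1, 0), (-(1 / 2), -(√3 / 2)),
      (1 / 2, -(√3 / 2))} := by
  have e0 : (((0 : Fin 6) : ℕ) : ℝ) * Real.pi / 3 = 0 := by simp
  have e1 : (((1 : Fin 6) : ℕ) : ℝ) * Real.pi / 3 = Real.pi / 3 := by simp
  have e2 : (((2 : Fin 6) : ℕ) : ℝ) * Real.pi / 3 = Real.pi - Real.pi / 3 := by
    simp; ring
  have e3 : (((3 : Fin 6) : ℕ) : ℝ) * Real.pi / 3 = Real.pi := by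
    have : ((3 : Fin 6) : ℕ) = 3 := rfl
    rw [this]; push_cast; ring
  have e4 : (((4 : Fin 6) : ℕ) : ℝ) * Real.pi / 3 = Real.pi / 3 + Real.pi := by
    have : ((4 : Fin 6) : ℕ) = 4 := rfl
    rw [this]; push_cast; ring
  have e5 : (((5 : Fin 6) : ℕ) : ℝ) * Real.pi / 3 = - (Real.pi / 3) + 2 * Real.pi := by
    have : ((5 : Fin 6) : ℕ) = 5 := rfl
    rw [this]; push_cast; ring
  have E0 : ((Real.cos (((0 : Fin 6) : ℕ) * Real.pi / 3), Real.sin (((0 : Fin 6) : ℕ) * Real.pi / 3)) : ℝ × ℝ) = (1, 0) := by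
    rw [e0]; simp
  have E1 : ((Real.cos (((1 : Fin 6) : ℕ) * Real.pi / 3), Real.sin (((1 : Fin 6) : ℕ) * Real.pi / 3)) : ℝ × ℝ) = (1 / 2, √3 / 2) := by
    rw [e1]; simp
  have E2 : ((Real.cos (((2 : Fin 6) : ℕ) * Real.pi / 3), Real.sin (((2 : Fin 6) : ℕ) * Real.pi / 3)) : ℝ × ℝ) = (-(1 / 2), √3 / 2) := by
    rw [e2, Real.cos_pi_sub, Real.sin_pi_sub]; simp
  have E3 : ((Real.cos (((3 : Fin 6) : ℕ) * Real.pi / 3), Real.sin (((3 : Fin 6) : ℕ) * Real.pi / 3)) : ℝ × ℝ) = (-1, 0) := by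
    rw [e3]; simp
  have E4 : ((Real.cos (((4 : Fin 6) : ℕ) * Real.pi / 3), Real.sin (((4 : Fin 6) : ℕ) * Real.pi / 3)) : ℝ × ℝ) = (-(1 / 2), -(√3 / 2)) := by
    rw [e4, Real.cos_add_pi, Real.sin_add_pi]; simp
  have E5 : ((Real.cos (((5 : Fin 6) : ℕ) * Real.pi / 3), Real.sin (((5 : Fin 6) : ℕ) * Real.pi / 3)) : ℝ × ℝ) = (1 / 2, -(√3 / 2)) := by
    rw [e5, Real.cos_add_two_pi, Real.sin_add_two_pi, Real.cos_neg, Real.sin_neg]; simp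
  ext p
  simp only [mem_range, mem_insert_iff, mem_singleton_iff]
  constructor
  · rintro ⟨k, rfl⟩
    fin_cases k
    · left; exact E0
    · right; left; exact E1
    · right; right; left; exact E2
    · right; right; right; left; exact E3
    · right; right; right; right; left; exact E4
    · right; right; right; right; right; exact E5
  · rintro (rfl | rfl | rfl | rfl | rfl | rfl)
    · exact ⟨0, E0⟩
    · exact ⟨1, E1⟩
    · exact ⟨2, E2⟩
    · exact ⟨3, E3⟩
    · exact ⟨4, E4⟩
    · exact ⟨5, E5⟩

lemma hull_HC : convexHull ℝ (Set.range fun k : Fin 6 =>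
    ((Real.cos (k * Real.pi / 3), Real.sin (k * Real.pi / 3)) : ℝ × ℝ)) = HC := by
  rw [hexpts]
  have h3 := s3
  apply Subset.antisymm
  · apply convexHull_min _ HC_convex
    rintro p (rfl | rfl | rfl | rfl | rfl | rfl) <;>
    refine ⟨⟨?_, ?_⟩, ⟨?_, ?_⟩, ⟨?_, ?_⟩⟩ <;> dsimp only <;> nlinarith
  · intro p hp
    obtain ⟨⟨h1, h2⟩, ⟨h3, h4⟩, ⟨h5, h6⟩⟩ := hp
    set S := convexHull ℝ ({(1, 0), (1 / 2, √3 / 2), (-(1 / 2), √3 / 2), (-1, 0),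
      (-(1 / 2), -(√3 / 2)), (1 / 2, -(√3 / 2))} : Set (ℝ × ℝ)) with hS
    have cS : Convex ℝ S := convex_convexHull ℝ _
    have m0 : ((1 : ℝ), (0 : ℝ)) ∈ S := subset_convexHull ℝ _ (by simp)
    have m1 : ((1 / 2 : ℝ), √3 / 2) ∈ S := subset_convexHull ℝ _ (by simp)
    have m2 : ((-(1 / 2) : ℝ), √3 / 2) ∈ S := subset_convexHull ℝ _ (by simp)
    have m3 : ((-1 : ℝ), (0 : ℝ)) ∈ S := subset_convexHull ℝ _ (by simp)
    have m4 : ((-(1 / 2) : ℝ), -(√3 / 2)) ∈ S := subset_convexHull ℝ _ (by simp)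
    have m5 : ((1 / 2 : ℝ), -(√3 / 2)) ∈ S := subset_convexHull ℝ _ (by simp)
    have mz : ((0 : ℝ), (0 : ℝ)) ∈ S := by
      apply comb3 cS m0 m3 m3 (1 / 2) (1 / 2) 0 <;> norm_num
    obtain ⟨P, hP⟩ : ∃ P, P = (3 * p.1 - √3 * p.2) / 3 := ⟨_, rfl⟩
    obtain ⟨Q, hQ⟩ : ∃ Q, Q = 2 * (√3 * p.2) / 3 := ⟨_, rfl⟩
    have x1 : p.1 = P + Q / 2 := by rw [hP, hQ]; ring
    have x2 : p.2 = Q * (√3 / 2) := by rw [hQ]; linear_combination (- p.2 / 3) * s3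
    rcases le_total 0 P with hp | hp <;> rcases le_total 0 Q with hq | hq
    · apply comb3 cS m0 m1 mz P Q (1 - P - Q) <;>
        first | linarith | (simp only; rw [x1]; ring) | (simp only; rw [x2]; ring)
    · rcases le_total 0 (P + Q) with hr | hr
      · apply comb3 cS m0 m5 mz (P + Q) (-Q) (1 - P) <;>
        first | linarith | (simp only; rw [x1]; ring) | (simp only; rw [x2]; ring)
      · apply comb3 cS m4 m5 mz (-(P + Q)) P (1 + Q) <;>
        first | linarith | (simp only; rw [x1]; ring) | (simp only; rw [x2]; ring)
    · rcases le_total 0 (P + Q) with hr | hr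
      · apply comb3 cS m1 m2 mz (P + Q) (-P) (1 - Q) <;>
        first | linarith | (simp only; rw [x1]; ring) | (simp only; rw [x2]; ring)
      · apply comb3 cS m3 m2 mz (-(P + Q)) Q (1 + P) <;>
        first | linarith | (simp only; rw [x1]; ring) | (simp only; rw [x2]; ring)
    · apply comb3 cS m3 m4 mz (-P) (-Q) (1 + P + Q) <;>
        first | linarith | (simp only; rw [x1]; ring) | (simp only; rw [x2]; ring)

lemma OT_sub_hex : OT ⊆ regularHexagon := by
  unfold regularHexagon
  rw [hull_HC]
  apply interior_maximal _ OT_open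
  intro p hp
  obtain ⟨h1, h2, h3⟩ := OT_ineq hp
  refine ⟨⟨?_, ?_⟩, ⟨?_, ?_⟩, ⟨?_, ?_⟩⟩ <;> linarith

lemma hex_frontier {p : ℝ × ℝ} (hp : p ∈ frontier regularHexagon) (a b c : ℤ) :
    AA a b c p = 0 := by
  unfold regularHexagon at hp
  rw [hull_HC] at hp
  have hc : p ∈ HC := by
    have := frontier_interior_subset hp
    exact HC_closed.frontier_subset this
  have hn : p ∉ interior HC := by
    have := hp.2
    rwa [interior_interior] at this
  by_contra hne
  apply hn
  obtain ⟨⟨h1, h2⟩, ⟨h3, h4⟩, ⟨h5, h6⟩⟩ := hc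
  have o : ∀ f : ℝ × ℝ → ℝ, Continuous f → IsOpen {p : ℝ × ℝ | -3 < f p ∧ f p < 3} := fun f hf =>
    (isOpen_lt continuous_const hf).inter (isOpen_lt hf continuous_const)
  have op := (o (fun p => 2 * (√3 * p.2)) (by fun_prop)).inter
    ((o (fun p => 3 * p.1 - √3 * p.2) (by fun_prop)).inter
     (o (fun p => 3 * p.1 + √3 * p.2) (by fun_prop)))
  refine interior_maximal (s := HC) ?_ op ⟨⟨?_, ?_⟩, ⟨?_, ?_⟩, ⟨?_, ?_⟩⟩
  · rintro q ⟨⟨h1, h2⟩, ⟨h3, h4⟩, ⟨h5, h6⟩⟩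
    exact ⟨⟨h1.le, h2.le⟩, ⟨h3.le, h4.le⟩, ⟨h5.le, h6.le⟩⟩
  · exact lt_of_le_of_ne h1 fun e => hne (AA_zero2 a b c (-1) p (by push_cast; linarith))
  · exact lt_of_le_of_ne h2 fun e => hne (AA_zero2 a b c 1 p (by push_cast; linarith))
  · exact lt_of_le_of_ne h3 fun e => hne (AA_zero1 a b c (-1) p (by push_cast; linarith))
  · exact lt_of_le_of_ne h4 fun e => hne (AA_zero1 a b c 1 p (by push_cast; linarith))
  · exact lt_of_le_of_ne h5 fun e => hne (AA_zero3 a b c (-1) p (by push_cast; linarith))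
  · exact lt_of_le_of_ne h6 fun e => hne (AA_zero3 a b c 1 p (by push_cast; linarith))

/-- A nonzero Lamé function gives a hexagon eigenvalue. -/
lemma hex_eig (a b c : ℤ) (p0 : ℝ × ℝ) (hp0 : p0 ∈ OT) (h0 : AA a b c p0 ≠ 0) :
    IsDirichletEigenvalue regularHexagon (mu a b c) := by
  set w := (starRingEnd ℂ) (AA a b c p0) with hw
  let L : ℂ →L[ℝ] ℝ := Complex.reCLM ∘L (ContinuousLinearMap.mul ℝ ℂ w)
  have hL : ∀ v, L v = (w * v).re := fun v => rfl
  refine ⟨fun p => L (AA a b c p), ?_, ?_, ?_, ?_, ?_⟩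
  · exact (L.continuous.comp (asum_cont _ a b c)).continuousOn
  · exact (L.contDiff.comp (asum_smooth _ a b c)).contDiffOn
  · intro p hp
    simp [hex_frontier hp]
  · refine ⟨p0, OT_sub_hex hp0, ?_⟩
    simp only [hL, hw]
    rw [mul_comm, Complex.mul_conj, Complex.ofReal_re]
    simpa using h0
  · intro p _
    have d1 : (deriv fun x => L (AA a b c (x, p.2))) = fun x => L (Ax a b c (x, p.2)) := by
      ext x
      exact (L.hasFDerivAt.comp_hasDerivAt x (asum_dx _ a b c x p.2)).deriv
    have d2 : deriv (fun x => L (Ax a b c (x, p.2))) p.1 = L (Axx a b c p) :=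
      (L.hasFDerivAt.comp_hasDerivAt p.1 (asum_dx _ a b c p.1 p.2)).deriv
    have d3 : (deriv fun y => L (AA a b c (p.1, y))) = fun y => L (Ay a b c (p.1, y)) := by
      ext y
      exact (L.hasFDerivAt.comp_hasDerivAt y (asum_dy _ a b c p.1 y)).deriv
    have d4 : deriv (fun y => L (Ay a b c (p.1, y))) p.2 = L (Ayy a b c p) :=
      (L.hasFDerivAt.comp_hasDerivAt p.2 (asum_dy _ a b c p.1 p.2)).deriv
    unfold lap2
    simp only [d1, d3]
    rw [d2, d4, ← map_add, AA_lap]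
    have : -(mu a b c : ℂ) * AA a b c p = (-(mu a b c)) • AA a b c p := by
      simp
    rw [this, map_smul, smul_eq_mul]

lemma oneD {f f1 f2 : ℝ → ℝ} {g g1 g2 : ℝ → ℂ} {a b δ K : ℝ} (hab : a ≤ b)
    (hf : ∀ x ∈ Icc a b, HasDerivAt f (f1 x) x) (hf1 : ∀ x ∈ Icc a b, HasDerivAt f1 (f2 x) x)
    (hg : ∀ x ∈ Icc a b, HasDerivAt g (g1 x) x) (hg1 : ∀ x ∈ Icc a b, HasDerivAt g1 (g2 x) x)
    (hc : ContinuousOn (fun x => (f x : ℂ) * g2 x - (f2 x : ℂ) * g x) (Icc a b))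
    (ga : g a = 0) (gb : g b = 0) (fa : |f a| ≤ δ) (fb : |f b| ≤ δ) (Ka : ‖g1 a‖ ≤ K)
    (Kb : ‖g1 b‖ ≤ K) :
    ‖∫ x in a..b, ((f x : ℂ) * g2 x - (f2 x : ℂ) * g x)‖ ≤ 2 * (δ * K) := by
  have hδ : 0 ≤ δ := (abs_nonneg _).trans fa
  have key : ∫ x in a..b, ((f x : ℂ) * g2 x - (f2 x : ℂ) * g x) =
      ((f b : ℂ) * g1 b - (f1 b : ℂ) * g b) - ((f a : ℂ) * g1 a - (f1 a : ℂ) * g a) := by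
    apply intervalIntegral.integral_eq_sub_of_hasDerivAt
      (f := fun x => (f x : ℂ) * g1 x - (f1 x : ℂ) * g x)
    · intro x hx
      rw [uIcc_of_le hab] at hx
      have h1 := ((hf x hx).ofReal_comp.mul (hg1 x hx)).sub ((hf1 x hx).ofReal_comp.mul (hg x hx))
      exact h1.congr_deriv (by ring)
    · apply ContinuousOn.intervalIntegrable
      rwa [uIcc_of_le hab]
  rw [key, ga, gb, mul_zero, mul_zero, sub_zero, sub_zero]
  refine (norm_sub_le _ _).trans ?_
  rw [norm_mul, norm_mul, Complex.norm_real, Complex.norm_real, Real.norm_eq_abs, Real.norm_eq_abs]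
  have := mul_le_mul fa Ka (norm_nonneg _) hδ
  have := mul_le_mul fb Kb (norm_nonneg _) hδ
  linarith

lemma CT_meas : MeasurableSet CT := CT_closed.measurableSet

lemma bound_of_slices {F : ℝ → ℂ} {M : ℝ} (h : ∀ y ∈ Icc (0 : ℝ) 1, ‖F y‖ ≤ M)
    (h0 : ∀ y, y ∉ Icc (0 : ℝ) 1 → F y = 0) : ‖∫ y, F y‖ ≤ M := by
  rw [← setIntegral_eq_integral_of_forall_compl_eq_zero h0]
  have := norm_setIntegral_le_of_norm_le_const (μ := volume) (s := Icc (0 : ℝ) 1) (C := M)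
    (by simp) h
  simpa using this

lemma slice_x (y x : ℝ) : (x, y) ∈ CT ↔ (0 ≤ y ∧ x ∈ Icc (√3 * y / 3) (1 - √3 * y / 3)) := by
  constructor
  · intro h
    obtain ⟨h1, h2, h3⟩ := CT_ineq h
    exact ⟨h.1, by dsimp at *; linarith, by dsimp at *; linarith⟩
  · rintro ⟨h0, h1, h2⟩
    have := s3; have := s3pos
    refine ⟨h0, ?_, ?_⟩
    · dsimp
      have := mul_le_mul_of_nonneg_left h1 s3pos.le
      nlinarith
    · dsimp
      have := mul_le_mul_of_nonneg_left h2 s3pos.le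
      nlinarith

lemma slice_y (x y : ℝ) : (x, y) ∈ CT ↔ y ∈ Icc 0 (min (√3 * x) (√3 * (1 - x))) := by
  simp [CT]

lemma fub_x {G : ℝ × ℝ → ℂ} (hG : ContinuousOn G CT) {M : ℝ} (hM : 0 ≤ M)
    (h : ∀ y, 0 ≤ y → √3 * y / 3 ≤ 1 - √3 * y / 3 →
      ‖∫ x in (√3 * y / 3)..(1 - √3 * y / 3), G (x, y)‖ ≤ M) : ‖∫ p in CT, G p‖ ≤ M := by
  have hi : IntegrableOn G CT := hG.integrableOn_compact CT_compact
  rw [← integral_indicator CT_meas]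
  have hi2 : Integrable (CT.indicator G) (volume.prod volume) :=
    (integrable_indicator_iff CT_meas).2 hi
  rw [Measure.volume_eq_prod, integral_prod_symm _ hi2]
  apply bound_of_slices
  · intro y hy
    have e : ∀ x, CT.indicator G (x, y) =
        (Icc (√3 * y / 3) (1 - √3 * y / 3)).indicator (fun x => G (x, y)) x := fun x => by
      by_cases hx : x ∈ Icc (√3 * y / 3) (1 - √3 * y / 3)
      · rw [indicator_of_mem hx, indicator_of_mem ((slice_x y x).2 ⟨hy.1, hx⟩)]
      · rw [indicator_of_notMem hx, indicator_of_notMem fun hh => hx ((slice_x y x).1 hh).2]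
    simp only [e]
    rw [integral_indicator measurableSet_Icc]
    by_cases hab : √3 * y / 3 ≤ 1 - √3 * y / 3
    · rw [integral_Icc_eq_integral_Ioc, ← intervalIntegral.integral_of_le hab]
      exact h y hy.1 hab
    · rw [Icc_eq_empty hab]; simpa using hM
  · intro y hy
    have e : ∀ x, CT.indicator G (x, y) = 0 := fun x => by
      apply indicator_of_notMem
      intro hh
      have := CT_box hh
      exact hy ⟨this.2.2.1, this.2.2.2⟩
    simp [e]

lemma fub_y {G : ℝ × ℝ → ℂ} (hG : ContinuousOn G CT) {M : ℝ} (hM : 0 ≤ M)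
    (h : ∀ x, 0 ≤ min (√3 * x) (√3 * (1 - x)) →
      ‖∫ y in (0)..(min (√3 * x) (√3 * (1 - x))), G (x, y)‖ ≤ M) : ‖∫ p in CT, G p‖ ≤ M := by
  have hi : IntegrableOn G CT := hG.integrableOn_compact CT_compact
  rw [← integral_indicator CT_meas]
  have hi2 : Integrable (CT.indicator G) (volume.prod volume) :=
    (integrable_indicator_iff CT_meas).2 hi
  rw [Measure.volume_eq_prod, integral_prod _ hi2]
  apply bound_of_slices
  · intro x _
    have e : ∀ y, CT.indicator G (x, y) =
        (Icc 0 (min (√3 * x) (√3 * (1 - x)))).indicator (fun y => G (x, y)) y := fun y => by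
      by_cases hx : y ∈ Icc 0 (min (√3 * x) (√3 * (1 - x)))
      · rw [indicator_of_mem hx, indicator_of_mem ((slice_y x y).2 hx)]
      · rw [indicator_of_notMem hx, indicator_of_notMem fun hh => hx ((slice_y x y).1 hh)]
    simp only [e]
    rw [integral_indicator measurableSet_Icc]
    by_cases hab : 0 ≤ min (√3 * x) (√3 * (1 - x))
    · rw [integral_Icc_eq_integral_Ioc, ← intervalIntegral.integral_of_le hab]
      exact h x hab
    · rw [Icc_eq_empty hab]; simpa using hM
  · intro x hx
    have e : ∀ y, CT.indicator G (x, y) = 0 := fun y => by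
      apply indicator_of_notMem
      intro hh
      have := CT_box hh
      exact hx ⟨this.1, this.2.1⟩
    simp [e]

/-- homothety about an interior point -/
noncomputable def hh (t : ℝ) (p : ℝ × ℝ) : ℝ × ℝ :=
  (1 / 2 + t * (p.1 - 1 / 2), 1 / 4 + t * (p.2 - 1 / 4))

lemma hh_mem {t : ℝ} (h0 : 0 < t) (h1 : t < 1) {p : ℝ × ℝ} (hp : p ∈ CT) : hh t p ∈ OT := by
  obtain ⟨a1, a2, a3⟩ := hp
  obtain ⟨b1, b2, b3⟩ := cent_mem
  have h1' : 0 < 1 - t := by linarith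
  have := mul_le_mul_of_nonneg_left a1 h0.le
  have := mul_le_mul_of_nonneg_left a2 h0.le
  have := mul_le_mul_of_nonneg_left a3 h0.le
  have := mul_lt_mul_of_pos_left b1 h1'
  have := mul_lt_mul_of_pos_left b2 h1'
  have := mul_lt_mul_of_pos_left b3 h1'
  refine ⟨?_, ?_, ?_⟩ <;> simp only [hh] at * <;> linarith

lemma hh_cont (t : ℝ) : Continuous (hh t) := by unfold hh; fun_prop

lemma hh_dist {t : ℝ} (h1 : t < 1) {p : ℝ × ℝ} (hp : p ∈ CT) : dist (hh t p) p ≤ 1 - t := by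
  obtain ⟨a1, a2, a3, a4⟩ := CT_box hp
  rw [Prod.dist_eq, Real.dist_eq, Real.dist_eq]
  have e1 : (hh t p).1 - p.1 = (1 - t) * (1 / 2 - p.1) := by simp [hh]; ring
  have e2 : (hh t p).2 - p.2 = (1 - t) * (1 / 4 - p.2) := by simp [hh]; ring
  rw [e1, e2, abs_mul, abs_mul, abs_of_pos (by linarith : 0 < 1 - t)]
  have b1 : |1 / 2 - p.1| ≤ 1 := by rw [abs_le]; constructor <;> linarith
  have b2 : |1 / 4 - p.2| ≤ 1 := by rw [abs_le]; constructor <;> linarith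
  apply max_le <;> nlinarith

lemma dir_facts {u : ℝ × ℝ → ℝ} (hs : ContDiffOn ℝ 2 u OT) (v : ℝ × ℝ) :
    ∃ u1 u2 : ℝ × ℝ → ℝ, ContinuousOn u2 OT ∧
      (∀ p ∈ OT, ∃ L : ℝ × ℝ →L[ℝ] ℝ, HasFDerivAt u L p ∧ L v = u1 p) ∧
      (∀ p ∈ OT, ∃ L : ℝ × ℝ →L[ℝ] ℝ, HasFDerivAt u1 L p ∧ L v = u2 p) := by
  have d1 : ContDiffOn ℝ 1 (fderiv ℝ u) OT := hs.fderiv_of_isOpen OT_open (by norm_num)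
  have d2 : ContDiffOn ℝ 1 (fun p => fderiv ℝ u p v) OT := d1.clm_apply contDiffOn_const
  have d3 : ContinuousOn (fderiv ℝ (fun p => fderiv ℝ u p v)) OT :=
    d2.continuousOn_fderiv_of_isOpen OT_open (by norm_num)
  refine ⟨fun p => fderiv ℝ u p v, fun p => fderiv ℝ (fun p => fderiv ℝ u p v) p v, ?_, ?_, ?_⟩
  · exact d3.clm_apply continuousOn_const
  · intro p hp
    refine ⟨_, ((hs.differentiableOn (by norm_num)).differentiableAt
      (OT_open.mem_nhds hp)).hasFDerivAt, rfl⟩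
  · intro p hp
    refine ⟨_, ((d2.differentiableOn (by norm_num)).differentiableAt
      (OT_open.mem_nhds hp)).hasFDerivAt, rfl⟩

lemma dx_of {w w1 : ℝ × ℝ → ℝ}
    (h : ∀ p ∈ OT, ∃ L : ℝ × ℝ →L[ℝ] ℝ, HasFDerivAt w L p ∧ L (1, 0) = w1 p) (k : ℝ)
    (q : ℝ × ℝ → ℝ × ℝ) (x y : ℝ) (hq : q (x, y) ∈ OT)
    (hd : HasDerivAt (fun x => q (x, y)) (k, 0) x) :
    HasDerivAt (fun x => w (q (x, y))) (k * w1 (q (x, y))) x := by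
  obtain ⟨L, hL, e⟩ := h _ hq
  have := hL.comp_hasDerivAt x hd
  refine this.congr_deriv ?_
  rw [← e, ← smul_eq_mul, ← map_smul]
  simp

lemma dy_of {w w1 : ℝ × ℝ → ℝ}
    (h : ∀ p ∈ OT, ∃ L : ℝ × ℝ →L[ℝ] ℝ, HasFDerivAt w L p ∧ L (0, 1) = w1 p) (k : ℝ)
    (q : ℝ × ℝ → ℝ × ℝ) (x y : ℝ) (hq : q (x, y) ∈ OT)
    (hd : HasDerivAt (fun y => q (x, y)) (0, k) y) :
    HasDerivAt (fun y => w (q (x, y))) (k * w1 (q (x, y))) y := by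
  obtain ⟨L, hL, e⟩ := h _ hq
  have := hL.comp_hasDerivAt y hd
  refine this.congr_deriv ?_
  rw [← e, ← smul_eq_mul, ← map_smul]
  simp

lemma hh_dx (t x y : ℝ) : HasDerivAt (fun x => hh t (x, y)) (t, 0) x := by
  have h1 := (((hasDerivAt_id' x).sub_const (1 / 2)).const_mul t).const_add (1 / 2)
  rw [mul_one] at h1
  exact h1.prodMk (hasDerivAt_const x (1 / 4 + t * (y - 1 / 4)))

lemma hh_dy (t x y : ℝ) : HasDerivAt (fun y => hh t (x, y)) (0, t) y := by
  have h1 := (((hasDerivAt_id' y).sub_const (1 / 4)).const_mul t).const_add (1 / 4)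
  rw [mul_one] at h1
  exact (hasDerivAt_const y (1 / 2 + t * (x - 1 / 2))).prodMk h1

lemma lap2_eq {u u1 u11 u2 u22 : ℝ × ℝ → ℝ}
    (h1 : ∀ p ∈ OT, ∃ L : ℝ × ℝ →L[ℝ] ℝ, HasFDerivAt u L p ∧ L (1, 0) = u1 p)
    (h11 : ∀ p ∈ OT, ∃ L : ℝ × ℝ →L[ℝ] ℝ, HasFDerivAt u1 L p ∧ L (1, 0) = u11 p)
    (h2 : ∀ p ∈ OT, ∃ L : ℝ × ℝ →L[ℝ] ℝ, HasFDerivAt u L p ∧ L (0, 1) = u2 p)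
    (h22 : ∀ p ∈ OT, ∃ L : ℝ × ℝ →L[ℝ] ℝ, HasFDerivAt u2 L p ∧ L (0, 1) = u22 p)
    (p : ℝ × ℝ) (hp : p ∈ OT) : lap2 u p = u11 p + u22 p := by
  have ex : ∀ x y, HasDerivAt (fun x : ℝ => (x, y)) ((1 : ℝ), (0 : ℝ)) x := fun x y =>
    (hasDerivAt_id' x).prodMk (hasDerivAt_const _ _)
  have ey : ∀ x y, HasDerivAt (fun y : ℝ => (x, y)) ((0 : ℝ), (1 : ℝ)) y := fun x y =>
    (hasDerivAt_const _ _).prodMk (hasDerivAt_id' y)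
  unfold lap2
  have nx : ∀ᶠ x in 𝓝 p.1, (x, p.2) ∈ OT :=
    (ex p.1 p.2).continuousAt (OT_open.mem_nhds hp)
  have ny : ∀ᶠ y in 𝓝 p.2, (p.1, y) ∈ OT :=
    (ey p.1 p.2).continuousAt (OT_open.mem_nhds hp)
  have a1 : (deriv fun x => u (x, p.2)) =ᶠ[𝓝 p.1] fun x => u1 (x, p.2) := by
    filter_upwards [nx] with x hx
    simpa using (dx_of h1 1 id x p.2 hx (ex x p.2)).deriv
  have a2 : (deriv fun y => u (p.1, y)) =ᶠ[𝓝 p.2] fun y => u2 (p.1, y) := by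
    filter_upwards [ny] with y hy
    simpa using (dy_of h2 1 id p.1 y hy (ey p.1 y)).deriv
  rw [a1.deriv_eq, a2.deriv_eq]
  congr 1
  · simpa using (dx_of h11 1 id p.1 p.2 hp (ex _ _)).deriv
  · simpa using (dy_of h22 1 id p.1 p.2 hp (ey _ _)).deriv

lemma AA_bdry (a b c : ℤ) {p : ℝ × ℝ} (h : p ∈ CT) (h' : p ∉ OT) : AA a b c p = 0 := by
  by_contra hne
  apply h'
  obtain ⟨h1, h2, h3⟩ := h
  refine ⟨lt_of_le_of_ne h1 fun e => ?_, lt_of_le_of_ne h2 fun e => ?_,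
    lt_of_le_of_ne h3 fun e => ?_⟩
  · exact hne (AA_zero2 a b c 0 p (by rw [← e]; simp))
  · refine hne (AA_zero1 a b c 0 p ?_)
    push_cast
    linear_combination -√3 * e - p.1 * s3
  · refine hne (AA_zero3 a b c 1 p ?_)
    push_cast
    linear_combination √3 * e + (1 - p.1) * s3

lemma green_t {u : ℝ × ℝ → ℝ} {lam : ℝ} (hc : ContinuousOn u CT) (hs : ContDiffOn ℝ 2 u OT)
    (hl : ∀ p ∈ OT, lap2 u p = -lam * u p) (a b c : ℤ) {t δ K : ℝ} (t0 : 0 < t) (t1 : t < 1)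
    (hδ : ∀ p ∈ CT, p ∉ OT → |u (hh t p)| ≤ δ) (hδ0 : 0 ≤ δ) (hK0 : 0 ≤ K)
    (hKx : ∀ p ∈ CT, ‖Ax a b c p‖ ≤ K) (hKy : ∀ p ∈ CT, ‖Ay a b c p‖ ≤ K) :
    ‖((t ^ 2 * lam - mu a b c : ℝ) : ℂ) * ∫ p in CT, (u (hh t p) : ℂ) * AA a b c p‖
      ≤ 4 * (δ * K) := by
  obtain ⟨u1, u11, c1, h1, h11⟩ := dir_facts hs (1, 0)
  obtain ⟨u2, u22, c2, h2, h22⟩ := dir_facts hs (0, 1)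
  have cu : ContinuousOn (fun p => u (hh t p)) CT :=
    hc.comp (hh_cont t).continuousOn fun p hp => OT_sub (hh_mem t0 t1 hp)
  have cu1 : ContinuousOn (fun p => t * (t * u11 (hh t p))) CT :=
    continuousOn_const.mul (continuousOn_const.mul
      (c1.comp (hh_cont t).continuousOn fun p hp => hh_mem t0 t1 hp))
  have cu2 : ContinuousOn (fun p => t * (t * u22 (hh t p))) CT :=
    continuousOn_const.mul (continuousOn_const.mul
      (c2.comp (hh_cont t).continuousOn fun p hp => hh_mem t0 t1 hp))
  have cA : Continuous (AA a b c) := asum_cont _ _ _ _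
  have cAx : Continuous (Axx a b c) := asum_cont _ _ _ _
  have cAy : Continuous (Ayy a b c) := asum_cont _ _ _ _
  have co : ∀ {f : ℝ × ℝ → ℝ}, ContinuousOn f CT → ContinuousOn (fun p => (f p : ℂ)) CT :=
    fun hf => Complex.continuous_ofReal.comp_continuousOn hf
  have cG1 : ContinuousOn (fun p => (u (hh t p) : ℂ) * Axx a b c p -
      ((t * (t * u11 (hh t p)) : ℝ) : ℂ) * AA a b c p) CT :=
    ((co cu).mul cAx.continuousOn).sub ((co cu1).mul cA.continuousOn)
  have cG2 : ContinuousOn (fun p => (u (hh t p) : ℂ) * Ayy a b c p -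
      ((t * (t * u22 (hh t p)) : ℝ) : ℂ) * AA a b c p) CT :=
    ((co cu).mul cAy.continuousOn).sub ((co cu2).mul cA.continuousOn)
  have B1 := fub_x (M := 2 * (δ * K)) cG1 (by positivity) (by
    intro y hy hab
    have hmem : ∀ x ∈ Icc (√3 * y / 3) (1 - √3 * y / 3), (x, y) ∈ CT := fun x hx =>
      (slice_x y x).2 ⟨hy, hx⟩
    have ml := hmem _ (left_mem_Icc.2 hab)
    have mr := hmem _ (right_mem_Icc.2 hab)
    have nl : (√3 * y / 3, y) ∉ OT := fun h => by
      have := (OT_ineq h).2.1; dsimp at this; linarith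
    have nr : (1 - √3 * y / 3, y) ∉ OT := fun h => by
      have := (OT_ineq h).2.2; dsimp at this; linarith
    refine oneD (f := fun x => u (hh t (x, y))) (f1 := fun x => t * u1 (hh t (x, y)))
      (f2 := fun x => t * (t * u11 (hh t (x, y)))) (g := fun x => AA a b c (x, y))
      (g1 := fun x => Ax a b c (x, y)) (g2 := fun x => Axx a b c (x, y)) hab ?_ ?_ ?_ ?_ ?_
      (AA_bdry a b c ml nl) (AA_bdry a b c mr nr) (hδ _ ml nl) (hδ _ mr nr) (hKx _ ml) (hKx _ mr)
    · intro x hx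
      exact dx_of h1 t (hh t) x y (hh_mem t0 t1 (hmem x hx)) (hh_dx t x y)
    · intro x hx
      exact (dx_of h11 t (hh t) x y (hh_mem t0 t1 (hmem x hx)) (hh_dx t x y)).const_mul t
    · intro x hx; exact asum_dx _ a b c x y
    · intro x hx; exact asum_dx _ a b c x y
    · exact cG1.comp (f := fun x : ℝ => (x, y)) (by fun_prop) hmem)
  have B2 := fub_y (M := 2 * (δ * K)) cG2 (by positivity) (by
    intro x hab
    have hmem : ∀ y ∈ Icc 0 (min (√3 * x) (√3 * (1 - x))), (x, y) ∈ CT := fun y hy =>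
      (slice_y x y).2 hy
    have ml := hmem _ (left_mem_Icc.2 hab)
    have mr := hmem _ (right_mem_Icc.2 hab)
    have nl : (x, 0) ∉ OT := fun h => by
      have := h.1; dsimp at this; linarith
    have nr : (x, min (√3 * x) (√3 * (1 - x))) ∉ OT := fun h => by
      have e1 := h.2.1
      have e2 := h.2.2
      dsimp at e1 e2
      exact lt_irrefl _ (lt_min e1 e2)
    refine oneD (f := fun y => u (hh t (x, y))) (f1 := fun y => t * u2 (hh t (x, y)))
      (f2 := fun y => t * (t * u22 (hh t (x, y)))) (g := fun y => AA a b c (x, y))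
      (g1 := fun y => Ay a b c (x, y)) (g2 := fun y => Ayy a b c (x, y)) hab ?_ ?_ ?_ ?_ ?_
      (AA_bdry a b c ml nl) (AA_bdry a b c mr nr) (hδ _ ml nl) (hδ _ mr nr) (hKy _ ml) (hKy _ mr)
    · intro y hy
      exact dy_of h2 t (hh t) x y (hh_mem t0 t1 (hmem y hy)) (hh_dy t x y)
    · intro y hy
      exact (dy_of h22 t (hh t) x y (hh_mem t0 t1 (hmem y hy)) (hh_dy t x y)).const_mul t
    · intro y hy; exact asum_dy _ a b c x y
    · intro y hy; exact asum_dy _ a b c x y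
    · exact cG2.comp (f := fun y : ℝ => (x, y)) (by fun_prop) hmem)
  have E : ((t ^ 2 * lam - mu a b c : ℝ) : ℂ) * ∫ p in CT, (u (hh t p) : ℂ) * AA a b c p =
      (∫ p in CT, ((u (hh t p) : ℂ) * Axx a b c p -
      ((t * (t * u11 (hh t p)) : ℝ) : ℂ) * AA a b c p)) +
      ∫ p in CT, ((u (hh t p) : ℂ) * Ayy a b c p -
      ((t * (t * u22 (hh t p)) : ℝ) : ℂ) * AA a b c p) := by
    rw [← integral_add (cG1.integrableOn_compact CT_compact) (cG2.integrableOn_compact CT_compact),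
      ← integral_const_mul]
    apply setIntegral_congr_fun CT_meas
    intro p hp
    have e1 := AA_lap a b c p
    have hp' := hh_mem t0 t1 hp
    have e2 := hl _ hp'
    rw [lap2_eq h1 h11 h2 h22 _ hp'] at e2
    have e3 : ((u11 (hh t p) : ℂ)) + u22 (hh t p) = -lam * u (hh t p) := by exact_mod_cast e2
    push_cast
    linear_combination (- (u (hh t p) : ℂ)) * e1 + t ^ 2 * AA a b c p * e3
  rw [E]
  refine (norm_add_le _ _).trans ?_
  linarith

lemma green {u : ℝ × ℝ → ℝ} {lam : ℝ} (hc : ContinuousOn u CT) (hs : ContDiffOn ℝ 2 u OT)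
    (h0 : ∀ p ∈ CT, p ∉ OT → u p = 0)
    (hl : ∀ p ∈ OT, lap2 u p = -lam * u p) (a b c : ℤ) :
    ((lam - mu a b c : ℝ) : ℂ) * ∫ p in CT, (u p : ℂ) * AA a b c p = 0 := by
  obtain ⟨K1, hK1⟩ := CT_compact.exists_bound_of_continuousOn
    (f := Ax a b c) (asum_cont _ _ _ _).continuousOn
  obtain ⟨K2, hK2⟩ := CT_compact.exists_bound_of_continuousOn
    (f := Ay a b c) (asum_cont _ _ _ _).continuousOn
  obtain ⟨K3, hK3⟩ := CT_compact.exists_bound_of_continuousOn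
    (f := AA a b c) (asum_cont _ _ _ _).continuousOn
  obtain ⟨K4, hK4⟩ := CT_compact.exists_bound_of_continuousOn hc
  set K := max K1 K2 with hK
  have hcm := OT_sub cent_mem
  have K0 : 0 ≤ K := (norm_nonneg _).trans ((hK1 _ hcm).trans (le_max_left _ _))
  have K30 : 0 ≤ K3 := (norm_nonneg _).trans (hK3 _ hcm)
  have K40 : 0 ≤ K4 := (norm_nonneg _).trans (hK4 _ hcm)
  have cA : Continuous (AA a b c) := asum_cont _ _ _ _
  have ev : ∀ᶠ t in 𝓝[<] (1 : ℝ), 0 < t ∧ t < 1 := by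
    filter_upwards [Ioo_mem_nhdsLT (zero_lt_one' ℝ)] with t ht using ht
  have lim : Tendsto (fun t => ((t ^ 2 * lam - mu a b c : ℝ) : ℂ) *
      ∫ p in CT, (u (hh t p) : ℂ) * AA a b c p) (𝓝[<] (1 : ℝ))
      (𝓝 (((lam - mu a b c : ℝ) : ℂ) * ∫ p in CT, (u p : ℂ) * AA a b c p)) := by
    apply Tendsto.mul
    · have : Continuous (fun t : ℝ => ((t ^ 2 * lam - mu a b c : ℝ) : ℂ)) := by fun_prop
      have h := this.tendsto 1
      simp only [one_pow, one_mul] at h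
      exact h.mono_left inf_le_left
    · apply tendsto_integral_filter_of_dominated_convergence (fun _ => K4 * K3)
      · filter_upwards [ev] with t ht
        have : ContinuousOn (fun p => (u (hh t p) : ℂ) * AA a b c p) CT :=
          (Complex.continuous_ofReal.comp_continuousOn (hc.comp (hh_cont t).continuousOn
            fun p hp => OT_sub (hh_mem ht.1 ht.2 hp))).mul cA.continuousOn
        exact this.aestronglyMeasurable CT_meas
      · filter_upwards [ev] with t ht
        filter_upwards [ae_restrict_mem CT_meas] with p hp
        rw [norm_mul, Complex.norm_real]
        exact mul_le_mul (hK4 _ (OT_sub (hh_mem ht.1 ht.2 hp))) (hK3 _ hp) (norm_nonneg _) K40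
      · have : IsFiniteMeasure (volume.restrict CT) :=
          ⟨by simpa using CT_compact.measure_lt_top⟩
        exact integrable_const _
      · filter_upwards [ae_restrict_mem CT_meas] with p hp
        apply Tendsto.mul_const
        apply (Complex.continuous_ofReal.tendsto _).comp
        apply (hc p hp).tendsto.comp
        apply tendsto_nhdsWithin_of_tendsto_nhds_of_eventually_within
        · have : Continuous (fun t => hh t p) := by unfold hh; fun_prop
          have h := this.tendsto 1
          have e : hh 1 p = p := by simp [hh]
          rw [e] at h
          exact h.mono_left inf_le_left
        · filter_upwards [ev] with t ht using OT_sub (hh_mem ht.1 ht.2 hp)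
  have hz : ∀ δ > 0, ‖((lam - mu a b c : ℝ) : ℂ) * ∫ p in CT, (u p : ℂ) * AA a b c p‖ ≤
      4 * (δ * K) := by
    intro δ hδ
    apply le_of_tendsto lim.norm
    have uc := CT_compact.uniformContinuousOn_of_continuous hc
    rw [Metric.uniformContinuousOn_iff] at uc
    obtain ⟨η, hη, huc⟩ := uc δ hδ
    have ev2 : ∀ᶠ t in 𝓝[<] (1 : ℝ), 1 - η < t := by
      filter_upwards [Ioo_mem_nhdsLT (by linarith : 1 - η < 1)] with t ht using ht.1
    filter_upwards [ev, ev2] with t ht ht2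
    apply green_t hc hs hl a b c ht.1 ht.2 _ hδ.le K0
      (fun p hp => (hK1 p hp).trans (le_max_left _ _))
      (fun p hp => (hK2 p hp).trans (le_max_right _ _))
    intro p hp hp'
    have := huc (hh t p) (OT_sub (hh_mem ht.1 ht.2 hp)) p hp
      (lt_of_le_of_lt (hh_dist ht.2 hp) (by linarith))
    rw [h0 p hp hp', Real.dist_eq, sub_zero] at this
    exact this.le
  by_contra hne
  have hpos := norm_pos_iff.2 hne
  set N := ‖((lam - mu a b c : ℝ) : ℂ) * ∫ p in CT, (u p : ℂ) * AA a b c p‖ with hN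
  have := hz (N / (8 * (K + 1))) (by positivity)
  have h2 : 4 * (N / (8 * (K + 1)) * K) = N / 2 * (K / (K + 1)) := by field_simp; ring
  have h3 : K / (K + 1) ≤ 1 := by rw [div_le_one (by positivity)]; linarith
  nlinarith

lemma complete {u : ℝ × ℝ → ℝ} (hc : ContinuousOn u CT)
    (h : ∀ a b c : ℤ, ∫ p in CT, (u p : ℂ) * AA a b c p = 0) : ∀ p ∈ OT, u p = 0 := by
  haveI : CompactSpace CT := isCompact_iff_compactSpace.1 CT_compact
  let ν : Measure CT := Measure.comap Subtype.val volume
  have tr : ∀ f : ℝ × ℝ → ℂ, ∫ x : CT, f x ∂ν = ∫ x in CT, f x := fun f =>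
    integral_subtype_comap CT_meas f
  haveI : IsFiniteMeasure ν := ⟨by
    rw [Measure.comap_apply _ Subtype.val_injective
      (fun s hs => (MeasurableEmbedding.subtype_coe CT_meas).measurableSet_image.2 hs) _
      MeasurableSet.univ]
    simpa using CT_compact.measure_lt_top⟩
  have integ : ∀ f : C(CT, ℂ), Integrable f ν := fun f =>
    f.continuous.integrable_of_hasCompactSupport (HasCompactSupport.of_compactSpace _)
  let I0 : C(CT, ℂ) →ₗ[ℂ] ℂ :=
    { toFun := fun f => ∫ x, f x ∂ν
      map_add' := fun f g => integral_add (integ f) (integ g)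
      map_smul' := fun r f => integral_const_mul r _ }
  let I : C(CT, ℂ) →L[ℂ] ℂ := I0.mkContinuous (ν.real univ) (fun f => by
    have := norm_integral_le_of_norm_le_const (μ := ν) (f := f) (C := ‖f‖)
      (Eventually.of_forall fun x => f.norm_coe_le_norm x)
    rw [mul_comm]
    exact this)
  have hI : ∀ f : C(CT, ℂ), I f = ∫ x, f x ∂ν := fun f => rfl
  let U : C(CT, ℂ) := ⟨fun x => (u x : ℂ),
    Complex.continuous_ofReal.comp (continuousOn_iff_continuous_restrict.1 hc)⟩
  let B : ℤ → ℤ → ℤ → C(CT, ℂ) := fun a b c =>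
    ⟨fun x => AA a b c x, (asum_cont _ a b c).comp continuous_subtype_val⟩
  have zc : Continuous zz := by
    unfold zz
    exact ((kk_cont _ _ _).add (kk_cont _ _ _)).add (kk_cont _ _ _)
  let Z : C(CT, ℂ) := ⟨fun x => zz x, zc.comp continuous_subtype_val⟩
  have hB : ∀ a b c, I (U * B a b c) = 0 := fun a b c => by
    rw [hI]
    exact (tr (fun p => (u p : ℂ) * AA a b c p)).trans (h a b c)
  let S : Set C(CT, ℂ) := {f | ∀ a b c, I (U * B a b c * f) = 0}
  have S1 : (1 : C(CT, ℂ)) ∈ S := fun a b c => by rw [mul_one]; exact hB a b c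
  have Zmul : ∀ a b c, B a b c * Z = B (a + 1) b c + B a (b + 1) c + B a b (c + 1) := by
    intro a b c; ext x
    exact (mul_comm _ _).trans (zz_mul a b c x)
  have Zsmul : ∀ a b c, B a b c * star Z = B (a - 1) b c + B a (b - 1) c + B a b (c - 1) := by
    intro a b c; ext x
    exact (mul_comm _ _).trans (zz_conj_mul a b c x)
  have SZ : ∀ f ∈ S, Z * f ∈ S := by
    intro f hf a b c
    have : U * B a b c * (Z * f) = U * (B a b c * Z) * f := by ring
    rw [this, Zmul, mul_add, mul_add, add_mul, add_mul, map_add, map_add, hf, hf, hf]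
    simp
  have SZ' : ∀ f ∈ S, star Z * f ∈ S := by
    intro f hf a b c
    have : U * B a b c * (star Z * f) = U * (B a b c * star Z) * f := by ring
    rw [this, Zsmul, mul_add, mul_add, add_mul, add_mul, map_add, map_add, hf, hf, hf]
    simp
  have Sadj : ∀ f ∈ StarAlgebra.adjoin ℂ ({Z} : Set C(CT, ℂ)), ∀ g ∈ S, f * g ∈ S := by
    intro f hf
    rw [← StarSubalgebra.mem_toSubalgebra, StarAlgebra.adjoin_toSubalgebra] at hf
    induction hf using Algebra.adjoin_induction with
    | mem x hx =>
      rcases hx with hx | hx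
      · rw [mem_singleton_iff.1 hx]; exact SZ
      · have : x = star Z := by
          have := mem_singleton_iff.1 (Set.mem_star.1 hx)
          rw [← this, star_star]
        rw [this]; exact SZ'
    | algebraMap r =>
      intro g hg a b c
      rw [Algebra.algebraMap_eq_smul_one, smul_mul_assoc, one_mul, mul_smul_comm, map_smul, hg,
        smul_zero]
    | add x y _ _ hx hy =>
      intro g hg a b c
      rw [add_mul, mul_add, map_add, hx g hg, hy g hg, add_zero]
    | mul x y _ _ hx hy =>
      intro g hg
      rw [mul_assoc]
      exact hx _ (hy g hg)
  have dense := ContinuousMap.starSubalgebra_topologicalClosure_eq_top_of_separatesPoints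
    (StarAlgebra.adjoin ℂ ({Z} : Set C(CT, ℂ))) (by
      intro x y hxy
      refine ⟨Z, ⟨Z, StarAlgebra.subset_adjoin ℂ _ (mem_singleton _), rfl⟩, ?_⟩
      intro he
      exact hxy (Subtype.ext (zz_inj x.2 y.2 he)))
  have all : ∀ f : C(CT, ℂ), I (U * B 0 1 2 * f) = 0 := by
    intro f
    have hf : f ∈ (StarAlgebra.adjoin ℂ ({Z} : Set C(CT, ℂ))).topologicalClosure := by
      rw [dense]; trivial
    have hcl : IsClosed {f : C(CT, ℂ) | I (U * B 0 1 2 * f) = 0} :=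
      isClosed_eq (I.continuous.comp (continuous_const.mul continuous_id)) continuous_const
    have hsub : ((StarAlgebra.adjoin ℂ ({Z} : Set C(CT, ℂ)) : StarSubalgebra ℂ C(CT, ℂ)) :
        Set C(CT, ℂ)) ⊆ {f : C(CT, ℂ) | I (U * B 0 1 2 * f) = 0} := by
      intro g hg
      have := Sadj g hg 1 S1 0 1 2
      rwa [mul_one] at this
    exact closure_minimal hsub hcl hf
  have fin := all (star (U * B 0 1 2))
  rw [hI] at fin
  have e1 : ∫ p in CT, ‖(u p : ℂ) * AA 0 1 2 p‖ ^ 2 = 0 := by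
    have e2 := (tr (fun p => ((u p : ℂ) * AA 0 1 2 p) *
      (starRingEnd ℂ) ((u p : ℂ) * AA 0 1 2 p))).symm.trans fin
    simp only [Complex.mul_conj, Complex.normSq_eq_norm_sq] at e2
    rw [integral_complex_ofReal] at e2
    exact_mod_cast e2
  have cW : ContinuousOn (fun p => ‖(u p : ℂ) * AA 0 1 2 p‖ ^ 2) CT :=
    (((Complex.continuous_ofReal.comp_continuousOn hc).mul
      (asum_cont _ 0 1 2).continuousOn).norm).pow 2
  rw [setIntegral_eq_zero_iff_of_nonneg_ae (Eventually.of_forall fun p => by positivity)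
    (cW.integrableOn_compact CT_compact)] at e1
  have e3 : (fun p => ‖(u p : ℂ) * AA 0 1 2 p‖ ^ 2) =ᵐ[volume.restrict OT] fun _ => (0 : ℝ) :=
    ae_restrict_of_ae_restrict_of_subset OT_sub e1
  have e4 := Measure.eqOn_open_of_ae_eq e3 OT_open (cW.mono OT_sub) continuousOn_const
  intro p hp
  have := e4 hp
  have hA := AA_ne p hp
  simpa [hA] using this

end Lame

theorem stmt4 (lam : ℝ) (h : IsDirichletEigenvalue equilateralTriangle lam) :
    IsDirichletEigenvalue regularHexagon lam := by
  obtain ⟨u, hc, hs, hb, ⟨p, hp, hne⟩, hl⟩ := h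
  rw [Lame.tri_eq] at hc hs hb hp hl
  rw [Lame.closure_OT] at hc
  have ex : ∃ a b c : ℤ, ∫ p in Lame.CT, (u p : ℂ) * Lame.AA a b c p ≠ 0 := by
    by_contra hcon
    push Not at hcon
    exact hne (Lame.complete hc hcon p hp)
  obtain ⟨a, b, c, hi⟩ := ex
  have hg := Lame.green hc hs (fun p h1 h2 => hb p (Lame.frontier_OT h1 h2)) hl a b c
  have hlam : lam = Lame.mu a b c := by
    rcases mul_eq_zero.1 hg with h | h
    · exact sub_eq_zero.1 (by exact_mod_cast h)
    · exact absurd h hi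
  rw [hlam]
  have ex2 : ∃ q ∈ Lame.OT, Lame.AA a b c q ≠ 0 := by
    by_contra hcon
    push Not at hcon
    apply hi
    rw [setIntegral_congr_fun Lame.CT_meas (g := fun _ => (0 : ℂ))]
    · simp
    · intro q hq
      by_cases hq' : q ∈ Lame.OT
      · simp [hcon q hq']
      · simp [Lame.AA_bdry a b c hq hq']
  obtain ⟨q, hq, hqn⟩ := ex2
  exact Lame.hex_eig a b c q hq hqn
end
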